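/- arXiv:1406.6509 — 4 statements merged into one kernel-verified Lean document; each statement's English description precedes it below -/
import Mathlib

section
/- For every compact interval [α, β] ⊂ [2, +∞) there exists δ > 0 such that for all p ∈ [α, β] and all μ ∈ (μ₁(p), μ₁(p) + δ], problem (AP) (with exponent p and parameter μ) has no nontrivial solution. -/
open Set Filter Topology intervalIntegral

/-- `v` (with derivative `v'`) is a solution of problem (AP) with exponent `p`,
weight `a` and parameter `μ`: `v ∈ C¹[0,1]`, `r ↦ |v'|^{p-2} v'` is differentiable on `(0,1)`
with derivative `-(μ^{p-1}(p-1) r^{p-2} a(r) |v|^{p-2} v)`, and `v'(0) = v(1) = 0`. -/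
def APSol (p μ : ℝ) (a v v' : ℝ → ℝ) : Prop :=
  ContinuousOn v' (Icc 0 1) ∧
  (∀ r ∈ Icc (0:ℝ) 1, HasDerivWithinAt v (v' r) (Icc 0 1) r) ∧
  (∀ r ∈ Ioo (0:ℝ) 1,
    HasDerivAt (fun t => |v' t| ^ (p - 2) * v' t)
      (-(μ ^ (p - 1) * (p - 1) * r ^ (p - 2) * a r * (|v r| ^ (p - 2) * v r))) r) ∧
  v' 0 = 0 ∧ v 1 = 0

/-- The Rayleigh-quotient infimum `η₁(p)`. -/
noncomputable def eta1 (a : ℝ → ℝ) (p : ℝ) : ℝ :=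
  sInf { q : ℝ | ∃ v v' : ℝ → ℝ,
    ContinuousOn v' (Icc 0 1) ∧
    (∀ r ∈ Icc (0:ℝ) 1, HasDerivWithinAt v (v' r) (Icc 0 1) r) ∧
    v' 0 = 0 ∧ v 1 = 0 ∧ (∃ r ∈ Icc (0:ℝ) 1, v r ≠ 0) ∧
    q = (∫ r in (0:ℝ)..1, |v' r| ^ p) /
        ((p - 1) * ∫ r in (0:ℝ)..1, r ^ (p - 2) * a r * |v r| ^ p) }

/-- The principal eigenvalue `μ₁(p) = η₁(p)^{1/(p-1)}`. -/
noncomputable def mu1 (a : ℝ → ℝ) (p : ℝ) : ℝ := eta1 a p ^ (1 / (p - 1))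

/-- The map `x ↦ |x|^{p-2} x`. -/
noncomputable def phi (p x : ℝ) : ℝ := |x| ^ (p - 2) * x

theorem abs_rpow_split {p : ℝ} (hp : 2 ≤ p) (x : ℝ) : |x| ^ (p - 2) * |x| = |x| ^ (p - 1) := by
  rcases eq_or_ne x 0 with rfl | hx
  · simp only [abs_zero, mul_zero]
    rw [Real.zero_rpow (by linarith)]
  · have : 0 < |x| := abs_pos.mpr hx
    rw [← Real.rpow_add_one this.ne']
    congr 1; ring

theorem abs_rpow_split' {p : ℝ} (hp : 2 ≤ p) (x : ℝ) : |x| ^ (p - 1) * |x| = |x| ^ p := by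
  rcases eq_or_ne x 0 with rfl | hx
  · simp only [abs_zero, mul_zero]
    rw [Real.zero_rpow (by linarith)]
  · have : 0 < |x| := abs_pos.mpr hx
    rw [← Real.rpow_add_one this.ne']
    congr 1; ring

theorem abs_phi {p : ℝ} (hp : 2 ≤ p) (x : ℝ) : |phi p x| = |x| ^ (p - 1) := by
  unfold phi
  rw [abs_mul, abs_of_nonneg (by positivity : 0 ≤ |x| ^ (p - 2)), abs_rpow_split hp]

theorem phi_mul_self {p : ℝ} (hp : 2 ≤ p) (x : ℝ) : phi p x * x = |x| ^ p := by
  unfold phi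
  rw [mul_assoc, ← abs_mul_abs_self x, ← mul_assoc, abs_rpow_split hp, abs_rpow_split' hp]

theorem phi_of_nonneg {p : ℝ} (hp : 2 ≤ p) {x : ℝ} (hx : 0 ≤ x) : phi p x = x ^ (p - 1) := by
  have := abs_rpow_split hp x
  unfold phi
  rwa [abs_of_nonneg hx] at this ⊢

theorem phi_neg (p x : ℝ) : phi p (-x) = - phi p x := by
  unfold phi; rw [abs_neg]; ring

theorem phi_mul (p c x : ℝ) : phi p (c * x) = phi p c * phi p x := by
  unfold phi; rw [abs_mul, Real.mul_rpow (abs_nonneg _) (abs_nonneg _)]; ring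

theorem phi_zero (p : ℝ) : phi p 0 = 0 := by simp [phi]

theorem phi_continuous {p : ℝ} (hp : 2 ≤ p) : Continuous (phi p) := by
  unfold phi
  exact (continuous_abs.rpow_const (fun _ => Or.inr (by linarith))).mul continuous_id

theorem phi_lt {p : ℝ} (hp : 2 ≤ p) {x y : ℝ} (h : x < y) : phi p x < phi p y := by
  have key : ∀ {x y : ℝ}, 0 ≤ x → x < y → phi p x < phi p y := by
    intro x y hx hxy
    rw [phi_of_nonneg hp hx, phi_of_nonneg hp (hx.trans hxy.le)]
    exact Real.rpow_lt_rpow hx hxy (by linarith)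
  rcases le_or_gt 0 x with hx | hx
  · exact key hx h
  · rcases le_or_gt y 0 with hy | hy
    · have := key (neg_nonneg.mpr hy) (neg_lt_neg h)
      rw [phi_neg, phi_neg] at this
      linarith
    · have h1 := key le_rfl hy
      have h2 := key le_rfl (neg_pos.mpr hx)
      rw [phi_neg] at h2
      rw [phi_zero] at h1 h2
      linarith

theorem phi_le_imp {p : ℝ} (hp : 2 ≤ p) {x y : ℝ} (h : phi p x ≤ phi p y) : x ≤ y := by
  by_contra hc
  exact absurd (phi_lt hp (not_le.mp hc)) (not_lt.mpr h)

/-- A C¹ function on `[0,1]`. -/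
structure C1 (w w' : ℝ → ℝ) : Prop where
  cont' : ContinuousOn w' (Icc 0 1)
  der : ∀ r ∈ Icc (0:ℝ) 1, HasDerivWithinAt w (w' r) (Icc 0 1) r

theorem C1.cont {w w' : ℝ → ℝ} (h : C1 w w') : ContinuousOn w (Icc 0 1) :=
  fun r hr => (h.der r hr).continuousWithinAt

theorem C1.hasDerivAt {w w' : ℝ → ℝ} (h : C1 w w') {r : ℝ} (hr : r ∈ Ioo (0:ℝ) 1) :
    HasDerivAt w (w' r) r :=
  (h.der r ⟨hr.1.le, hr.2.le⟩).hasDerivAt (Icc_mem_nhds hr.1 hr.2)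

theorem C1.mvt {w w' : ℝ → ℝ} (h : C1 w w') {x y : ℝ} (hx : 0 ≤ x) (hxy : x < y) (hy : y ≤ 1) :
    ∃ c ∈ Ioo x y, w y - w x = w' c * (y - x) := by
  obtain ⟨c, hc, e⟩ := exists_hasDerivAt_eq_slope w w' hxy
    (h.cont.mono (Icc_subset_Icc hx hy))
    (fun r hr => h.hasDerivAt ⟨hx.trans_lt hr.1, hr.2.trans_le hy⟩)
  refine ⟨c, hc, ?_⟩
  rw [e]
  have : y - x ≠ 0 := by linarith
  field_simp

/-- Weight data and solution of the initial value problem. -/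
structure Sol (p L A : ℝ) (k v v' : ℝ → ℝ) : Prop where
  hp : 2 ≤ p
  hL : 0 < L
  hA : 0 < A
  kc : ContinuousOn k (Icc 0 1)
  k0 : ∀ r ∈ Icc (0:ℝ) 1, 0 ≤ k r
  kA : ∀ r ∈ Icc (0:ℝ) 1, k r ≤ A
  c1 : C1 v v'
  eq : ∀ r ∈ Ioo (0:ℝ) 1, HasDerivAt (fun t => phi p (v' t)) (-(L * k r * phi p (v r))) r
  z0 : v' 0 = 0

namespace Sol
variable {p L A : ℝ} {k v v' : ℝ → ℝ}

theorem smul (h : Sol p L A k v v') (c : ℝ) : Sol p L A k (fun r => c * v r) (fun r => c * v' r) where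
  hp := h.hp
  hL := h.hL
  hA := h.hA
  kc := h.kc
  k0 := h.k0
  kA := h.kA
  c1 := ⟨continuousOn_const.mul h.c1.cont', fun r hr => (h.c1.der r hr).const_mul c⟩
  eq := by
    intro r hr
    have := (h.eq r hr).const_mul (phi p c)
    simp only [phi_mul]
    exact this.congr_deriv (by ring)
  z0 := by simp [h.z0]

theorem gcont (h : Sol p L A k v v') : ContinuousOn (fun t => phi p (v' t)) (Icc 0 1) :=
  (phi_continuous h.hp).comp_continuousOn h.c1.cont'

theorem gbound (h : Sol p L A k v v') {x y M : ℝ} (hx : 0 ≤ x) (hxy : x ≤ y) (hy : y ≤ 1)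
    (hM : ∀ r ∈ Icc x y, |v r| ≤ M) :
    |phi p (v' y) - phi p (v' x)| ≤ L * A * M ^ (p - 1) * (y - x) := by
  rcases hxy.eq_or_lt with rfl | hlt
  · simp
  obtain ⟨c, hc, e⟩ := exists_hasDerivAt_eq_slope _ _ hlt
    (h.gcont.mono (Icc_subset_Icc hx hy))
    (fun r hr => h.eq r ⟨hx.trans_lt hr.1, hr.2.trans_le hy⟩)
  have hc1 : c ∈ Icc (0:ℝ) 1 := ⟨hx.trans hc.1.le, hc.2.le.trans hy⟩
  have e2 : phi p (v' y) - phi p (v' x) = -(L * k c * phi p (v c)) * (y - x) := by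
    rw [e]
    have : y - x ≠ 0 := by linarith
    field_simp
  rw [e2, abs_mul, abs_neg, abs_mul, abs_mul, abs_phi h.hp, abs_of_pos h.hL,
    abs_of_nonneg (h.k0 c hc1), abs_of_pos (sub_pos.mpr hlt)]
  have h1 := h.k0 c hc1
  have h2 := h.kA c hc1
  have h3 : |v c| ^ (p - 1) ≤ M ^ (p - 1) :=
    Real.rpow_le_rpow (abs_nonneg _) (hM c ⟨hc.1.le, hc.2.le⟩) (by linarith [h.hp])
  have h4 := h.hL.le
  have h5 : 0 ≤ y - x := by linarith
  have h6 := h.hA.le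
  gcongr

/-- Between a zero `x` and a critical point `m`, with `|v| ≤ M = |v m|`, `M > 0`: lower bound
on the distance. -/
theorem dist_bound (h : Sol p L A k v v') {x m c M d : ℝ} (hx : 0 ≤ x) (hxm : x < m) (hm : m ≤ 1)
    (hc : c = x ∨ c = m) (hd : m - x ≤ d)
    (hvx : v x = 0) (hvm : v' c = 0) (hM : ∀ r ∈ Icc x m, |v r| ≤ M) (hMm : |v m| = M)
    (hM0 : 0 < M) : 1 ≤ L * A * d ^ p := by
  have hp := h.hp
  obtain ⟨ξ, hξ, e⟩ := h.c1.mvt hx hxm hm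
  have hK : 0 < L * A := mul_pos h.hL h.hA
  have hd0 : 0 < m - x := by linarith
  have hg : |v' ξ| ^ (p - 1) ≤ L * A * M ^ (p - 1) * (m - x) := by
    rw [← abs_phi hp]
    rcases hc with rfl | rfl
    · have := h.gbound (x := c) (y := ξ) hx hξ.1.le (hξ.2.le.trans hm)
        (fun r hr => hM r ⟨hr.1, hr.2.trans hξ.2.le⟩)
      rw [hvm, phi_zero, sub_zero] at this
      refine this.trans ?_
      have := hξ.2.le
      gcongr
    · have := h.gbound (x := ξ) (y := c) (hx.trans hξ.1.le) hξ.2.le hm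
        (fun r hr => hM r ⟨hξ.1.le.trans hr.1, hr.2⟩)
      rw [hvm, phi_zero, zero_sub, abs_neg] at this
      refine this.trans ?_
      have := hξ.1.le
      gcongr
  have e2 : M = |v' ξ| * (m - x) := by
    rw [← hMm, ← abs_of_pos hd0, ← abs_mul, ← e, hvx, sub_zero]
  have e3 : M ^ (p - 1) ≤ L * A * (m - x) ^ p * M ^ (p - 1) := by
    calc M ^ (p - 1) = |v' ξ| ^ (p - 1) * (m - x) ^ (p - 1) := by
          rw [← Real.mul_rpow (abs_nonneg _) hd0.le, ← e2]
      _ ≤ L * A * M ^ (p - 1) * (m - x) * (m - x) ^ (p - 1) := by gcongr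
      _ = L * A * ((m - x) ^ (p - 1) * (m - x)) * M ^ (p - 1) := by ring
      _ = _ := by rw [← Real.rpow_add_one hd0.ne']; congr 3; ring
  have hMp : 0 < M ^ (p - 1) := Real.rpow_pos_of_pos hM0 _
  have e4 : 1 ≤ L * A * (m - x) ^ p := by
    by_contra hcon
    push Not at hcon
    nlinarith
  refine e4.trans ?_
  gcongr

theorem zero_step (h : Sol p L A k v v') {x d : ℝ} (hx : 0 ≤ x) (hd : L * A * d ^ p < 1)
    (hvx : v x = 0) (hvx' : v' x = 0) {y : ℝ} (hxy : x ≤ y) (hyd : y ≤ x + d) (hy : y ≤ 1) :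
    ∀ r ∈ Icc x y, v r = 0 := by
  obtain ⟨m, hm, hmax⟩ := isCompact_Icc.exists_isMaxOn (nonempty_Icc.mpr hxy)
    ((h.c1.cont.mono (Icc_subset_Icc hx hy)).abs)
  have hmax' : ∀ r ∈ Icc x y, |v r| ≤ |v m| := fun r hr => hmax hr
  by_cases h0 : v m = 0
  · intro r hr
    have := hmax' r hr
    rw [h0, abs_zero] at this
    exact abs_nonpos_iff.mp this
  · exfalso
    have hxm : x < m := by
      rcases hm.1.eq_or_lt with e | e
      · exact absurd (e ▸ hvx) h0
      · exact e
    have := h.dist_bound (d := d) hx hxm (hm.2.trans hy) (Or.inl rfl) (by linarith [hm.2]) hvx hvx'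
      (fun r hr => hmax' r ⟨hr.1, hr.2.trans hm.2⟩) rfl (abs_pos.mpr h0)
    linarith

theorem zero_deriv (h : Sol p L A k v v') {x y : ℝ} (hx : 0 ≤ x) (hxy : x < y) (hy : y ≤ 1)
    (hv : ∀ r ∈ Icc x y, v r = 0) {r : ℝ} (hr : r ∈ Icc x y) : v' r = 0 := by
  have h1 : HasDerivWithinAt v (v' r) (Icc x y) r :=
    (h.c1.der r ⟨hx.trans hr.1, hr.2.trans hy⟩).mono (Icc_subset_Icc hx hy)
  have h2 : HasDerivWithinAt v 0 (Icc x y) r :=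
    (hasDerivWithinAt_const r (Icc x y) (0:ℝ)).congr hv (hv r hr)
  exact (uniqueDiffOn_Icc hxy r hr).eq_deriv _ h1 h2

theorem unique (h : Sol p L A k v v') (h0 : v 0 = 0) : ∀ r ∈ Icc (0:ℝ) 1, v r = 0 := by
  have hK : 0 < L * A := mul_pos h.hL h.hA
  obtain ⟨d, hd0, hd⟩ : ∃ d : ℝ, 0 < d ∧ L * A * d ^ p < 1 := by
    refine ⟨min 1 (1 / (2 * (L * A))), by positivity, ?_⟩
    set d := min 1 (1 / (2 * (L * A))) with hdd
    have hd0 : 0 < d := by positivity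
    have h1 : d ^ p ≤ d ^ (1:ℝ) :=
      Real.rpow_le_rpow_of_exponent_ge hd0 (min_le_left _ _) (by linarith [h.hp])
    rw [Real.rpow_one] at h1
    have h2 : d ≤ 1 / (2 * (L * A)) := min_le_right _ _
    calc L * A * d ^ p ≤ L * A * (1 / (2 * (L * A))) := by gcongr; linarith
      _ < 1 := by rw [mul_one_div, div_lt_one (by positivity)]; linarith
  have key : ∀ n : ℕ, ∀ r ∈ Icc (0:ℝ) 1, r ≤ n * d → v r = 0 ∧ v' r = 0 := by
    intro n
    induction n with
    | zero =>
      intro r hr hrn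
      have : r = 0 := le_antisymm (by simpa using hrn) hr.1
      rw [this]; exact ⟨h0, h.z0⟩
    | succ n ih =>
      intro r hr hrn
      by_cases hc : r ≤ n * d
      · exact ih r hr hc
      · push Not at hc
        have hn : (0:ℝ) ≤ n * d := by positivity
        have hx := ih (n * d) ⟨hn, hc.le.trans hr.2⟩ le_rfl
        have hz := h.zero_step hn hd hx.1 hx.2 hc.le
          (by push_cast at hrn; linarith) hr.2
        exact ⟨hz r ⟨hc.le, le_rfl⟩, h.zero_deriv hn hc hr.2 hz ⟨hc.le, le_rfl⟩⟩
  intro r hr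
  obtain ⟨n, hn⟩ := exists_nat_ge (1 / d)
  refine (key n r hr (hr.2.trans ?_)).1
  rwa [div_le_iff₀ hd0] at hn

/-- Monotonicity on the first nodal interval. -/
theorem anti (h : Sol p L A k v v') {z : ℝ} (hz : z ≤ 1) (hv : ∀ r ∈ Ico (0:ℝ) z, 0 < v r) :
    ∀ x ∈ Icc (0:ℝ) z, ∀ y ∈ Icc (0:ℝ) z, x ≤ y → v' y ≤ v' x := by
  intro x hx y hy hxy
  apply phi_le_imp h.hp
  rcases hxy.eq_or_lt with rfl | hlt
  · exact le_rfl
  obtain ⟨c, hc, e⟩ := exists_hasDerivAt_eq_slope _ _ hlt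
    (h.gcont.mono (Icc_subset_Icc hx.1 (hy.2.trans hz)))
    (fun r hr => h.eq r ⟨hx.1.trans_lt hr.1, hr.2.trans_le (hy.2.trans hz)⟩)
  have hc1 : c ∈ Icc (0:ℝ) 1 := ⟨hx.1.trans hc.1.le, hc.2.le.trans (hy.2.trans hz)⟩
  have hvc := hv c ⟨hc1.1, hc.2.trans_le hy.2⟩
  have hph : 0 ≤ phi p (v c) := by rw [phi_of_nonneg h.hp hvc.le]; positivity
  have e2 : phi p (v' y) - phi p (v' x) = -(L * k c * phi p (v c)) * (y - x) := by
    rw [e]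
    have : y - x ≠ 0 := by linarith
    field_simp
  have h1 : 0 ≤ L * k c * phi p (v c) * (y - x) :=
    mul_nonneg (mul_nonneg (mul_nonneg h.hL.le (h.k0 c hc1)) hph) (by linarith)
  linarith

theorem nonpos (h : Sol p L A k v v') {z : ℝ} (hz : z ≤ 1) (hv : ∀ r ∈ Ico (0:ℝ) z, 0 < v r) :
    ∀ y ∈ Icc (0:ℝ) z, v' y ≤ 0 := by
  intro y hy
  have := h.anti hz hv 0 ⟨le_rfl, hy.1.trans hy.2⟩ y hy hy.1
  rwa [h.z0] at this

theorem concave (h : Sol p L A k v v') (hv : ∀ r ∈ Ico (0:ℝ) 1, 0 < v r) (h1 : v 1 = 0)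
    {b : ℝ} (hb : b ∈ Ioo (0:ℝ) 1) : (1 - b) * v 0 ≤ v b := by
  obtain ⟨x, hx, ex⟩ := h.c1.mvt le_rfl hb.1 hb.2.le
  obtain ⟨y, hy, ey⟩ := h.c1.mvt hb.1.le hb.2 le_rfl
  have := h.anti le_rfl hv x ⟨hx.1.le, (hx.2.trans hb.2).le⟩ y ⟨(hb.1.trans hy.1).le, hy.2.le⟩
    (hx.2.trans hy.1).le
  rw [h1] at ey
  have h2 : 0 < b * (1 - b) := mul_pos hb.1 (by linarith [hb.2])
  have e1 : b * (1 - b) * v' y = -(b * v b) := by linear_combination (-b) * ey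
  have e2 : b * (1 - b) * v' x = (1 - b) * (v b - v 0) := by linear_combination (-(1 - b)) * ex
  have h3 := mul_le_mul_of_nonneg_left this h2.le
  rw [e1, e2] at h3
  linarith

theorem young {p : ℝ} (hp : 2 ≤ p) {x y : ℝ} (hx : 0 ≤ x) (hy : 0 ≤ y) :
    p * (y * x ^ (p - 1)) ≤ y ^ p + (p - 1) * x ^ p := by
  have hc : p.HolderConjugate (p / (p - 1)) := by
    have := Real.HolderConjugate.conjExponent (p := p) (by linarith)
    simpa [Real.conjExponent] using this
  have h := Real.young_inequality_of_nonneg hy (Real.rpow_nonneg hx (p - 1)) hc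
  rw [← Real.rpow_mul hx, mul_div_cancel₀ p (by linarith : p - 1 ≠ 0)] at h
  have hp0 : 0 < p := by linarith
  have hp1 : p - 1 ≠ 0 := by linarith
  calc p * (y * x ^ (p - 1)) ≤ p * (y ^ p / p + x ^ p / (p / (p - 1))) := by gcongr
    _ = _ := by field_simp

theorem psi_cont {p L : ℝ} {k w w' : ℝ → ℝ} (hp : 2 ≤ p) (kc : ContinuousOn k (Icc 0 1))
    (hw : C1 w w') :
    ContinuousOn (fun r => |w' r| ^ p - L * (k r * |w r| ^ p)) (Icc 0 1) := by
  refine (hw.cont'.abs.rpow_const fun _ _ => Or.inr (by linarith)).sub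
    (continuousOn_const.mul (kc.mul (hw.cont.abs.rpow_const fun _ _ => Or.inr (by linarith))))

theorem psi_int {p L : ℝ} {k w w' : ℝ → ℝ} (hp : 2 ≤ p) (kc : ContinuousOn k (Icc 0 1))
    (hw : C1 w w') :
    (∫ r in (0:ℝ)..1, (|w' r| ^ p - L * (k r * |w r| ^ p))) =
      (∫ r in (0:ℝ)..1, |w' r| ^ p) - L * ∫ r in (0:ℝ)..1, k r * |w r| ^ p := by
  have hNc : ContinuousOn (fun r => |w' r| ^ p) (Icc 0 1) :=
    hw.cont'.abs.rpow_const fun _ _ => Or.inr (by linarith)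
  have hDc : ContinuousOn (fun r => k r * |w r| ^ p) (Icc 0 1) :=
    kc.mul (hw.cont.abs.rpow_const fun _ _ => Or.inr (by linarith))
  rw [intervalIntegral.integral_sub (hNc.intervalIntegrable_of_Icc zero_le_one)
    ((hDc.intervalIntegrable_of_Icc zero_le_one).const_mul L),
    intervalIntegral.integral_const_mul]

theorem picone_pt {p L k v v' w w' : ℝ} (hp : 2 ≤ p) (hv : 0 < v) :
    (p * |w| ^ (p - 2) * w * w') * (phi p v' * v ^ (1 - p)) +
      |w| ^ p * (-(L * k * phi p v) * v ^ (1 - p) + phi p v' * (v' * (1 - p) * v ^ (1 - p - 1)))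
      ≤ |w'| ^ p - L * (k * |w| ^ p) := by
  have e1 : phi p v * v ^ (1 - p) = 1 := by
    rw [phi_of_nonneg hp hv.le, ← Real.rpow_add hv]; simp
  have e2 : phi p v' * v' = |v'| ^ p := phi_mul_self hp v'
  have e3 : |w| ^ p * |v'| ^ p * v ^ (1 - p - 1) = (|w| * |v'| / v) ^ p := by
    rw [Real.div_rpow (by positivity) hv.le, Real.mul_rpow (abs_nonneg _) (abs_nonneg _),
      div_eq_mul_inv, ← Real.rpow_neg hv.le]
    congr 2; ring
  have e4 : |w| ^ (p - 1) * |v'| ^ (p - 1) * v ^ (1 - p) = (|w| * |v'| / v) ^ (p - 1) := by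
    rw [Real.div_rpow (by positivity) hv.le, Real.mul_rpow (abs_nonneg _) (abs_nonneg _),
      div_eq_mul_inv, ← Real.rpow_neg hv.le]
    congr 2; ring
  have hy := young hp (x := |w| * |v'| / v) (y := |w'|) (by positivity) (abs_nonneg _)
  rw [← e4, ← e3] at hy
  have h1 : (p * |w| ^ (p - 2) * w * w') * (phi p v' * v ^ (1 - p)) ≤
      p * (|w'| * (|w| ^ (p - 1) * |v'| ^ (p - 1) * v ^ (1 - p))) := by
    have : (p * |w| ^ (p - 2) * w * w') * (phi p v' * v ^ (1 - p)) =
      p * (w' * (phi p w * phi p v' * v ^ (1 - p))) := by unfold phi; ring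
    rw [this]
    have hp0 : 0 < p := by linarith
    apply mul_le_mul_of_nonneg_left _ hp0.le
    refine (le_abs_self _).trans (le_of_eq ?_)
    rw [abs_mul, abs_mul, abs_mul, abs_phi hp, abs_phi hp,
      abs_of_pos (Real.rpow_pos_of_pos hv (1 - p))]
  have h2 : |w| ^ p * (-(L * k * phi p v) * v ^ (1 - p) +
      phi p v' * (v' * (1 - p) * v ^ (1 - p - 1))) =
      - (L * (k * |w| ^ p)) * (phi p v * v ^ (1 - p))
        - (p - 1) * (|w| ^ p * (phi p v' * v') * v ^ (1 - p - 1)) := by ring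
  rw [h2, e1, e2]
  linarith

theorem picone (h : Sol p L A k v v') (hv : ∀ r ∈ Ico (0:ℝ) 1, 0 < v r) (h1 : v 1 = 0)
    {w w' : ℝ → ℝ} (hw : C1 w w') (hw1 : w 1 = 0) :
    0 ≤ ∫ r in (0:ℝ)..1, (|w' r| ^ p - L * (k r * |w r| ^ p)) := by
  have hp := h.hp
  set ψ : ℝ → ℝ := fun r => |w' r| ^ p - L * (k r * |w r| ^ p) with hψ
  have hψc : ContinuousOn ψ (Icc 0 1) := psi_cont hp h.kc hw
  have hv0 : 0 < v 0 := hv 0 ⟨le_rfl, one_pos⟩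
  obtain ⟨W, hW⟩ := isCompact_Icc.exists_bound_of_continuousOn hw.cont'
  obtain ⟨G, hG⟩ := isCompact_Icc.exists_bound_of_continuousOn h.gcont
  simp only [Real.norm_eq_abs] at hW hG
  have hW0 : 0 ≤ W := (abs_nonneg _).trans (hW 0 ⟨le_rfl, zero_le_one⟩)
  have hG0 : 0 ≤ G := (abs_nonneg _).trans (hG 0 ⟨le_rfl, zero_le_one⟩)
  set C := W ^ p * G * v 0 ^ (1 - p) with hC
  have main : ∀ b ∈ Ioo (0:ℝ) 1, 0 ≤ (∫ r in (0:ℝ)..b, ψ r) + C * (1 - b) := by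
    intro b hb
    have hb1 : 0 < 1 - b := by linarith [hb.2]
    have hsub : Icc 0 b ⊆ Icc (0:ℝ) 1 := Icc_subset_Icc le_rfl hb.2.le
    have hvp : ∀ r ∈ Icc 0 b, 0 < v r := fun r hr => hv r ⟨hr.1, hr.2.trans_lt hb.2⟩
    have key := intervalIntegral.sub_le_integral_of_hasDeriv_right_of_le
      (g := fun r => |w r| ^ p * (phi p (v' r) * v r ^ (1 - p)))
      (g' := fun r => (p * |w r| ^ (p - 2) * w r * w' r) * (phi p (v' r) * v r ^ (1 - p)) +
        |w r| ^ p * (-(L * k r * phi p (v r)) * v r ^ (1 - p) +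
          phi p (v' r) * (v' r * (1 - p) * v r ^ (1 - p - 1))))
      (φ := ψ) hb.1.le
      (by
        refine ((hw.cont.mono hsub).abs.rpow_const fun _ _ => Or.inr (by linarith)).mul
          ((h.gcont.mono hsub).mul
            ((h.c1.cont.mono hsub).rpow_const fun r hr => Or.inl (hvp r hr).ne')))
      (by
        intro r hr
        have hr1 : r ∈ Ioo (0:ℝ) 1 := ⟨hr.1, hr.2.trans hb.2⟩
        have d1 : HasDerivAt (fun r => |w r| ^ p) (p * |w r| ^ (p - 2) * w r * w' r) r :=
          (hasDerivAt_abs_rpow (w r) (by linarith : 1 < p)).comp r (hw.hasDerivAt hr1)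
        have d2 := (h.c1.hasDerivAt hr1).rpow_const (p := 1 - p)
          (Or.inl (hvp r ⟨hr.1.le, hr.2.le⟩).ne')
        exact (d1.mul ((h.eq r hr1).mul d2)).hasDerivWithinAt)
      ((hψc.mono hsub).integrableOn_compact isCompact_Icc)
      (by
        intro r hr
        exact picone_pt hp (hvp r ⟨hr.1.le, hr.2.le⟩))
    simp only [h.z0, phi_zero, zero_mul, mul_zero, sub_zero] at key
    have hwb : |w b| ≤ W * (1 - b) := by
      obtain ⟨c, hc, e⟩ := hw.mvt hb.1.le hb.2 le_rfl
      rw [hw1, zero_sub] at e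
      rw [← abs_neg, e, abs_mul, abs_of_pos hb1]
      have := hW c ⟨(hb.1.trans hc.1).le, hc.2.le⟩
      gcongr
    have hvb := h.concave hv h1 hb
    have hvb' : v b ^ (1 - p) ≤ ((1 - b) * v 0) ^ (1 - p) :=
      Real.rpow_le_rpow_of_nonpos (by positivity) hvb (by linarith)
    have hF : |(|w b| ^ p * (phi p (v' b) * v b ^ (1 - p)))| ≤ C * (1 - b) := by
      have hvb0 := hvp b ⟨hb.1.le, le_rfl⟩
      rw [abs_mul, abs_mul, abs_of_nonneg (by positivity : 0 ≤ |w b| ^ p),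
        abs_of_pos (Real.rpow_pos_of_pos hvb0 (1 - p))]
      have := hG b ⟨hb.1.le, hb.2.le⟩
      calc |w b| ^ p * (|phi p (v' b)| * v b ^ (1 - p))
          ≤ (W * (1 - b)) ^ p * (G * ((1 - b) * v 0) ^ (1 - p)) := by gcongr
        _ = W ^ p * G * v 0 ^ (1 - p) * ((1 - b) ^ p * (1 - b) ^ (1 - p)) := by
          rw [Real.mul_rpow hW0 hb1.le, Real.mul_rpow hb1.le hv0.le]; ring
        _ = C * (1 - b) := by
          rw [← Real.rpow_add hb1]; simp [hC]
    have := (abs_le.mp hF).1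
    linarith
  have hcont : ContinuousOn (fun b => (∫ r in (0:ℝ)..b, ψ r) + C * (1 - b)) (Icc 0 1) := by
    refine ContinuousOn.add ?_ (by fun_prop)
    have := intervalIntegral.continuousOn_primitive_interval (a := (0:ℝ)) (b := 1) (f := ψ)
      (μ := MeasureTheory.volume)
      (by rw [uIcc_of_le zero_le_one]; exact hψc.integrableOn_compact isCompact_Icc)
    rwa [uIcc_of_le zero_le_one] at this
  have ht : Tendsto (fun b => (∫ r in (0:ℝ)..b, ψ r) + C * (1 - b)) (𝓝[Ioo 0 1] 1)
      (𝓝 ((∫ r in (0:ℝ)..1, ψ r) + C * (1 - 1))) :=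
    ((hcont 1 ⟨zero_le_one, le_rfl⟩).mono Ioo_subset_Icc_self)
  rw [nhdsWithin_Ioo_eq_nhdsLT one_pos] at ht
  have := ge_of_tendsto ht (by
    rw [← nhdsWithin_Ioo_eq_nhdsLT (one_pos : (0:ℝ) < 1)]
    exact eventually_nhdsWithin_of_forall main)
  simpa using this

theorem bern {p : ℝ} (hp : 2 ≤ p) {x t : ℝ} (hx : 0 < x) (ht : 0 ≤ t) :
    x ^ (p - 1) * (x + p * t) ≤ (x + t) ^ p := by
  have h1 := one_add_mul_self_le_rpow_one_add (s := t / x) (p := p)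
    (by have : 0 ≤ t / x := by positivity
        linarith) (by linarith)
  have h2 : (x + t) ^ p = x ^ p * (1 + t / x) ^ p := by
    rw [← Real.mul_rpow hx.le (by positivity)]; congr 1; field_simp
  have h3 : x ^ p = x ^ (p - 1) * x := by rw [← Real.rpow_add_one hx.ne']; congr 1; ring
  rw [h2]
  calc x ^ (p - 1) * (x + p * t) = x ^ p * (1 + p * (t / x)) := by rw [h3]; field_simp
    _ ≤ _ := by gcongr

/-- The main gap estimate. -/
theorem gap (h : Sol p L A k v v') {z : ℝ} (hz0 : 0 < z) (hz1 : z < 1)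
    (hv : ∀ r ∈ Ico (0:ℝ) z, 0 < v r) (hvz : v z = 0) (hv0 : v 0 = 1) (h1 : v 1 = 0) :
    ∃ w w' : ℝ → ℝ, C1 w w' ∧ w' 0 = 0 ∧ w 1 = 0 ∧ w 0 ≠ 0 ∧
      (∫ r in (0:ℝ)..1, |w' r| ^ p) ≤
        (L - 1 / (2 * L * A ^ 2 * 2 ^ p)) * ∫ r in (0:ℝ)..1, k r * |w r| ^ p := by
  have hp := h.hp
  have hL := h.hL
  have hA := h.hA
  have hzI : z ∈ Icc (0:ℝ) 1 := ⟨hz0.le, hz1.le⟩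
  have hz1' : 0 < 1 - z := by linarith
  have hsub : Icc 0 z ⊆ Icc (0:ℝ) 1 := Icc_subset_Icc le_rfl hz1.le
  set s := - v' z with hs
  have hs1 : 1 ≤ s := by
    obtain ⟨c, hc, e⟩ := h.c1.mvt le_rfl hz0 hz1.le
    have := h.anti hz1.le hv c ⟨hc.1.le, hc.2.le⟩ z ⟨hz0.le, le_rfl⟩ hc.2.le
    rw [hvz, hv0] at e
    nlinarith
  have hs0 : 0 < s := by linarith
  -- lower bound on `1 - z`
  have hdist : 1 ≤ L * A * (1 - z) := by
    obtain ⟨m, hm, hmax⟩ := isCompact_Icc.exists_isMaxOn (nonempty_Icc.mpr hz1.le)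
      ((h.c1.cont.mono (Icc_subset_Icc hz0.le le_rfl)).abs)
    have hmax' : ∀ r ∈ Icc z 1, |v r| ≤ |v m| := fun r hr => hmax hr
    have hvm : v m ≠ 0 := by
      intro h0
      have hzero : ∀ r ∈ Icc z 1, v r = 0 := by
        intro r hr
        have := hmax' r hr
        rw [h0, abs_zero] at this
        exact abs_nonpos_iff.mp this
      have := h.zero_deriv hz0.le hz1 le_rfl hzero (r := z) ⟨le_rfl, hz1.le⟩
      rw [this] at hs
      linarith
    have hzm : z < m := lt_of_le_of_ne hm.1 (fun e => hvm (e ▸ hvz))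
    have hm1 : m < 1 := lt_of_le_of_ne hm.2 (fun e => hvm (e ▸ h1))
    have hder := h.c1.hasDerivAt (r := m) ⟨hz0.trans hzm, hm1⟩
    have hnear : ∀ᶠ r in 𝓝 m, |v r| ≤ |v m| := by
      filter_upwards [Icc_mem_nhds hzm hm1] with r hr using hmax' r hr
    have hcrit : v' m = 0 := by
      refine IsLocalExtr.hasDerivAt_eq_zero ?_ hder
      rcases lt_or_gt_of_ne hvm with hneg | hpos
      · left
        filter_upwards [hnear] with r hr
        rw [abs_of_neg hneg] at hr
        linarith [neg_abs_le (v r)]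
      · right
        filter_upwards [hnear] with r hr
        rw [abs_of_pos hpos] at hr
        exact (le_abs_self _).trans hr
    have := h.dist_bound (d := 1 - z) hz0.le hzm hm.2 (Or.inr rfl) (by linarith) hvz hcrit
      (fun r hr => hmax' r ⟨hr.1, hr.2.trans hm.2⟩) rfl (abs_pos.mpr hvm)
    refine this.trans ?_
    have h2 : (1 - z) ^ p ≤ (1 - z) ^ (1:ℝ) :=
      Real.rpow_le_rpow_of_exponent_ge hz1' (by linarith) (by linarith)
    rw [Real.rpow_one] at h2
    gcongr
  set t := s * (1 - z) / 2 with ht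
  have ht0 : 0 < t := by positivity
  set w : ℝ → ℝ := fun r => if r ≤ z then v r + t else s * (1 - r) ^ 2 / (2 * (1 - z)) with hw
  set w' : ℝ → ℝ := fun r => if r ≤ z then v' r else - (s * (1 - r) / (1 - z)) with hw'
  have hwl : ∀ r ∈ Icc 0 z, w r = v r + t := fun r hr => by simp [hw, hr.2]
  have hwl' : ∀ r ∈ Icc 0 z, w' r = v' r := fun r hr => by simp [hw', hr.2]
  have hwr : ∀ r ∈ Icc z 1, w r = s * (1 - r) ^ 2 / (2 * (1 - z)) := fun r hr => by
    rcases hr.1.eq_or_lt with rfl | hlt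
    · simp only [hw, le_refl, if_true, hvz, ht]; field_simp; ring
    · simp [hw, not_le.mpr hlt]
  have hwr' : ∀ r ∈ Icc z 1, w' r = - (s * (1 - r) / (1 - z)) := fun r hr => by
    rcases hr.1.eq_or_lt with rfl | hlt
    · simp only [hw', le_refl, if_true, hs]; field_simp
    · simp [hw', not_le.mpr hlt]
  have hun : Icc (0:ℝ) z ∪ Icc z 1 = Icc 0 1 := Icc_union_Icc_eq_Icc hz0.le hz1.le
  have hC1 : C1 w w' := by
    have dl : ∀ r ∈ Icc 0 z, HasDerivWithinAt w (w' r) (Icc 0 z) r := by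
      intro r hr
      have := ((h.c1.der r (hsub hr)).mono hsub).add_const t
      rw [hwl' r hr]
      exact this.congr hwl (hwl r hr)
    have dr : ∀ r ∈ Icc z 1, HasDerivWithinAt w (w' r) (Icc z 1) r := by
      intro r hr
      have d : HasDerivAt (fun r : ℝ => s * (1 - r) ^ 2 / (2 * (1 - z)))
          (- (s * (1 - r) / (1 - z))) r := by
        have := ((((hasDerivAt_id r).const_sub 1).pow 2).const_mul s).div_const (2 * (1 - z))
        refine this.congr_deriv ?_
        simp; field_simp
      rw [hwr' r hr]
      exact d.hasDerivWithinAt.congr hwr (hwr r hr)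
    constructor
    · rw [← hun]
      refine ContinuousOn.union_of_isClosed ?_ ?_ isClosed_Icc isClosed_Icc
      · exact (h.c1.cont'.mono hsub).congr hwl'
      · refine ContinuousOn.congr ?_ hwr'
        fun_prop
    · intro r hr
      rcases lt_trichotomy r z with hlt | heq | hgt
      · refine (dl r ⟨hr.1, hlt.le⟩).mono_of_mem_nhdsWithin ?_
        rw [mem_nhdsWithin]
        exact ⟨Iio z, isOpen_Iio, hlt, fun y hy => ⟨hy.2.1, (le_of_lt hy.1)⟩⟩
      · have := (dl r ⟨hr.1, heq.le⟩).union (dr r ⟨heq.ge, hr.2⟩)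
        rwa [hun] at this
      · refine (dr r ⟨hgt.le, hr.2⟩).mono_of_mem_nhdsWithin ?_
        rw [mem_nhdsWithin]
        exact ⟨Ioi z, isOpen_Ioi, hgt, fun y hy => ⟨(le_of_lt hy.1), hy.2.2⟩⟩
  have hψc := psi_cont (L := L) hp h.kc hC1
  have hsub2 : Icc z 1 ⊆ Icc (0:ℝ) 1 := Icc_subset_Icc hz0.le le_rfl
  -- left part
  have hleft : (∫ r in (0:ℝ)..z, (|w' r| ^ p - L * (k r * |w r| ^ p))) ≤
      - (p * t * s ^ (p - 1)) := by
    have key := intervalIntegral.integral_le_sub_of_hasDeriv_right_of_le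
      (g := fun r => phi p (v' r) * (v r + p * t))
      (g' := fun r => -(L * k r * phi p (v r)) * (v r + p * t) + phi p (v' r) * v' r)
      (φ := fun r => |w' r| ^ p - L * (k r * |w r| ^ p)) hz0.le
      ((h.gcont.mono hsub).mul ((h.c1.cont.mono hsub).add continuousOn_const))
      (fun r hr => ((h.eq r ⟨hr.1, hr.2.trans hz1⟩).mul
        ((h.c1.hasDerivAt ⟨hr.1, hr.2.trans hz1⟩).add_const (p * t))).hasDerivWithinAt)
      ((hψc.mono hsub).integrableOn_compact isCompact_Icc)
      (by
        intro r hr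
        have hrI : r ∈ Icc 0 z := ⟨hr.1.le, hr.2.le⟩
        have hvr := hv r ⟨hr.1.le, hr.2⟩
        rw [hwl r hrI, hwl' r hrI, phi_mul_self hp, phi_of_nonneg hp hvr.le,
          abs_of_pos (by linarith : 0 < v r + t)]
        have hb := bern hp hvr ht0.le
        have hLk : 0 ≤ L * k r := mul_nonneg hL.le (h.k0 r (hsub hrI))
        nlinarith [mul_le_mul_of_nonneg_left hb hLk])
    refine key.trans (le_of_eq ?_)
    simp only [h.z0, phi_zero, hvz]
    have : phi p (v' z) = - s ^ (p - 1) := by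
      rw [show v' z = - s by rw [hs]; ring, phi_neg, phi_of_nonneg hp hs0.le]
    rw [this]; ring
  have hright : (∫ r in z..1, (|w' r| ^ p - L * (k r * |w r| ^ p))) ≤ t * s ^ (p - 1) := by
    have hsp : s ^ p = s ^ (p - 1) * s := by
      rw [← Real.rpow_add_one hs0.ne']; congr 1; ring
    have key := intervalIntegral.integral_le_sub_of_hasDeriv_right_of_le
      (g := fun r => - (s ^ p * (1 - r) ^ 2 / (2 * (1 - z))))
      (g' := fun r => s ^ p * ((1 - r) / (1 - z)))
      (φ := fun r => |w' r| ^ p - L * (k r * |w r| ^ p)) hz1.le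
      (by fun_prop)
      (by
        intro r hr
        have := (((((hasDerivAt_id r).const_sub 1).pow 2).const_mul (s ^ p)).div_const
          (2 * (1 - z))).neg
        refine (this.congr_deriv ?_).hasDerivWithinAt
        simp; field_simp)
      ((hψc.mono hsub2).integrableOn_compact isCompact_Icc)
      (by
        intro r hr
        have hrI : r ∈ Icc z 1 := ⟨hr.1.le, hr.2.le⟩
        have h0 : 0 ≤ L * (k r * |w r| ^ p) :=
          mul_nonneg hL.le (mul_nonneg (h.k0 r (hsub2 hrI)) (by positivity))
        have hr1 : 0 < 1 - r := by linarith [hr.2]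
        have hq : 0 < (1 - r) / (1 - z) := by positivity
        have hq1 : (1 - r) / (1 - z) ≤ 1 := by
          rw [div_le_one hz1']; linarith [hr.1]
        have h2 : ((1 - r) / (1 - z)) ^ p ≤ ((1 - r) / (1 - z)) ^ (1:ℝ) :=
          Real.rpow_le_rpow_of_exponent_ge hq hq1 (by linarith)
        rw [Real.rpow_one] at h2
        have h3 : |w' r| ^ p = s ^ p * ((1 - r) / (1 - z)) ^ p := by
          rw [hwr' r hrI, abs_neg, mul_div_assoc, abs_of_pos (mul_pos hs0 hq),
            Real.mul_rpow hs0.le hq.le]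
        have h4 : s ^ p * ((1 - r) / (1 - z)) ^ p ≤ s ^ p * ((1 - r) / (1 - z)) := by gcongr
        linarith)
    refine key.trans (le_of_eq ?_)
    rw [hsp, ht]; field_simp; ring
  have hi1 : IntervalIntegrable (fun r => |w' r| ^ p - L * (k r * |w r| ^ p))
      MeasureTheory.volume 0 z := (hψc.mono hsub).intervalIntegrable_of_Icc hz0.le
  have hi2 : IntervalIntegrable (fun r => |w' r| ^ p - L * (k r * |w r| ^ p))
      MeasureTheory.volume z 1 := (hψc.mono hsub2).intervalIntegrable_of_Icc hz1.le
  have htot : (∫ r in (0:ℝ)..1, (|w' r| ^ p - L * (k r * |w r| ^ p))) ≤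
      - ((p - 1) * t * s ^ (p - 1)) := by
    rw [← intervalIntegral.integral_add_adjacent_intervals hi1 hi2]
    linarith
  have hDc : ContinuousOn (fun r => k r * |w r| ^ p) (Icc 0 1) :=
    h.kc.mul (hC1.cont.abs.rpow_const fun _ _ => Or.inr (by linarith))
  rw [psi_int hp h.kc hC1] at htot
  -- upper bound on the denominator
  have hwb : ∀ r ∈ Icc (0:ℝ) 1, |w r| ≤ 2 * s := by
    intro r hr
    have hts : t ≤ s := by rw [ht]; nlinarith
    rcases le_total r z with hrz | hrz
    · have hrI : r ∈ Icc 0 z := ⟨hr.1, hrz⟩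
      rw [hwl r hrI]
      have hvr0 : 0 ≤ v r := by
        rcases hrz.eq_or_lt with e | e
        · rw [e, hvz]
        · exact (hv r ⟨hr.1, e⟩).le
      have hvr1 : v r ≤ 1 := by
        rcases hr.1.eq_or_lt with e | e
        · rw [← e, hv0]
        · obtain ⟨c, hc, e2⟩ := h.c1.mvt le_rfl e hr.2
          have := h.nonpos hz1.le hv c ⟨hc.1.le, hc.2.le.trans hrz⟩
          rw [hv0] at e2
          nlinarith
      rw [abs_of_nonneg (by linarith)]
      linarith
    · have hrI : r ∈ Icc z 1 := ⟨hrz, hr.2⟩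
      rw [hwr r hrI, abs_of_nonneg (by positivity), div_le_iff₀ (by positivity)]
      have h0 : 0 ≤ 1 - r := by linarith [hr.2]
      have h2 : (1 - r) ^ 2 ≤ 1 - z := by nlinarith
      nlinarith
  have hX : (∫ r in (0:ℝ)..1, k r * |w r| ^ p) ≤ A * (2 ^ p * s ^ p) := by
    have := intervalIntegral.integral_mono_on (μ := MeasureTheory.volume) zero_le_one
      (hDc.intervalIntegrable_of_Icc zero_le_one)
      (intervalIntegrable_const (c := A * (2 ^ p * s ^ p)))
      (by
        intro r hr
        rw [← Real.mul_rpow two_pos.le hs0.le]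
        have h2 := hwb r hr
        have h3 := h.kA r hr
        have h4 := h.k0 r hr
        gcongr)
    simpa using this
  refine ⟨w, w', hC1, ?_, ?_, ?_, ?_⟩
  · rw [hwl' 0 ⟨le_rfl, hz0.le⟩, h.z0]
  · rw [hwr 1 ⟨hz1.le, le_rfl⟩]; simp
  · rw [hwl 0 ⟨le_rfl, hz0.le⟩, hv0]; positivity
  · set X := ∫ r in (0:ℝ)..1, k r * |w r| ^ p
    set N := ∫ r in (0:ℝ)..1, |w' r| ^ p
    have hsp : s ^ p = s ^ (p - 1) * s := by
      rw [← Real.rpow_add_one hs0.ne']; congr 1; ring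
    have h2p : (0:ℝ) < 2 ^ p := by positivity
    have hκX : 1 / (2 * L * A ^ 2 * 2 ^ p) * X ≤ (p - 1) * t * s ^ (p - 1) := by
      calc 1 / (2 * L * A ^ 2 * 2 ^ p) * X
          ≤ 1 / (2 * L * A ^ 2 * 2 ^ p) * (A * (2 ^ p * s ^ p)) := by gcongr
        _ = s ^ p / (2 * L * A) := by field_simp
        _ ≤ s ^ p * (1 - z) / 2 := by
          rw [div_le_div_iff₀ (by positivity) (by positivity)]
          have : 0 < s ^ p := by positivity
          nlinarith
        _ = 1 * t * s ^ (p - 1) := by rw [hsp, ht]; ring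
        _ ≤ _ := by gcongr; linarith
    linarith

end Sol

theorem denom_pos {a : ℝ → ℝ}
    (ha : ContinuousOn a (Icc 0 1)) (ha0 : ∀ r ∈ Icc (0:ℝ) 1, 0 ≤ a r)
    (hanv : ∀ s t : ℝ, 0 ≤ s → s < t → t ≤ 1 → ∃ r ∈ Ioo s t, a r ≠ 0)
    {e p : ℝ} (he : 0 ≤ e) (hp : 0 ≤ p) {w : ℝ → ℝ} (hw : ContinuousOn w (Icc 0 1))
    (hne : ∃ r ∈ Icc (0:ℝ) 1, w r ≠ 0) :
    0 < ∫ r in (0:ℝ)..1, r ^ e * a r * |w r| ^ p := by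
  obtain ⟨r0, hr0, hwr0⟩ := hne
  have hev : ∀ᶠ r in 𝓝[Icc 0 1] r0, w r ≠ 0 := (hw r0 hr0).eventually_ne hwr0
  rw [eventually_nhdsWithin_iff, Metric.eventually_nhds_iff] at hev
  obtain ⟨ε, hε, hball⟩ := hev
  obtain ⟨c, hc, hac⟩ := hanv (max 0 (r0 - ε)) (min 1 (r0 + ε)) (le_max_left _ _)
    (by
      rw [max_lt_iff, lt_min_iff, lt_min_iff]
      exact ⟨⟨one_pos, by linarith [hr0.1]⟩, by linarith [hr0.2], by linarith⟩)
    (min_le_left _ _)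
  obtain ⟨hc1, hc2⟩ := hc
  rw [max_lt_iff] at hc1
  rw [lt_min_iff] at hc2
  have hcI : c ∈ Icc (0:ℝ) 1 := ⟨hc1.1.le, hc2.1.le⟩
  have hwc : w c ≠ 0 := hball (by
    rw [Real.dist_eq, abs_lt]; constructor <;> linarith [hc1.2, hc2.2]) hcI
  refine intervalIntegral.integral_pos one_pos ?_ ?_ ⟨c, hcI, ?_⟩
  · exact ((continuousOn_id.rpow_const fun _ _ => Or.inr he).mul ha).mul
      (hw.abs.rpow_const fun _ _ => Or.inr hp)
  · intro r hr
    have := ha0 r ⟨hr.1.le, hr.2⟩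
    have := hr.1.le
    positivity
  · have h1 : 0 < a c := lt_of_le_of_ne (ha0 c hcI) hac.symm
    have h2 : 0 < |w c| := abs_pos.mpr hwc
    have h3 := hc1.1
    positivity

theorem eta1_bdd (a : ℝ → ℝ) (ha0 : ∀ r ∈ Icc (0:ℝ) 1, 0 ≤ a r) {p : ℝ} (hp : 2 ≤ p) :
    ∀ q ∈ { q : ℝ | ∃ v v' : ℝ → ℝ,
    ContinuousOn v' (Icc 0 1) ∧
    (∀ r ∈ Icc (0:ℝ) 1, HasDerivWithinAt v (v' r) (Icc 0 1) r) ∧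
    v' 0 = 0 ∧ v 1 = 0 ∧ (∃ r ∈ Icc (0:ℝ) 1, v r ≠ 0) ∧
    q = (∫ r in (0:ℝ)..1, |v' r| ^ p) /
        ((p - 1) * ∫ r in (0:ℝ)..1, r ^ (p - 2) * a r * |v r| ^ p) }, 0 ≤ q := by
  rintro q ⟨v, v', -, -, -, -, -, rfl⟩
  apply div_nonneg
  · exact intervalIntegral.integral_nonneg zero_le_one fun r _ => by positivity
  · refine mul_nonneg (by linarith) (intervalIntegral.integral_nonneg zero_le_one fun r hr => ?_)
    have := ha0 r hr
    have := hr.1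
    positivity

theorem eta1_le {a : ℝ → ℝ} (ha0 : ∀ r ∈ Icc (0:ℝ) 1, 0 ≤ a r) {p : ℝ} (hp : 2 ≤ p)
    {w w' : ℝ → ℝ} (hw : C1 w w') (h0 : w' 0 = 0) (h1 : w 1 = 0)
    (hne : ∃ r ∈ Icc (0:ℝ) 1, w r ≠ 0) :
    eta1 a p ≤ (∫ r in (0:ℝ)..1, |w' r| ^ p) /
        ((p - 1) * ∫ r in (0:ℝ)..1, r ^ (p - 2) * a r * |w r| ^ p) :=
  csInf_le ⟨0, fun q hq => eta1_bdd a ha0 hp q hq⟩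
    ⟨w, w', hw.cont', hw.der, h0, h1, hne, rfl⟩

theorem eta1_nonneg {a : ℝ → ℝ} (ha0 : ∀ r ∈ Icc (0:ℝ) 1, 0 ≤ a r) {p : ℝ} (hp : 2 ≤ p) :
    0 ≤ eta1 a p :=
  Real.sInf_nonneg fun q hq => eta1_bdd a ha0 hp q hq

theorem c1_test : C1 (fun r => 1 - r ^ 2) (fun r => -(2 * r)) where
  cont' := by fun_prop
  der := fun r _ => by
    have := ((hasDerivAt_id r).pow 2).const_sub 1
    refine (this.congr_deriv ?_).hasDerivWithinAt
    simp

theorem test_ne : ∃ r ∈ Icc (0:ℝ) 1, (fun r : ℝ => 1 - r ^ 2) r ≠ 0 :=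
  ⟨0, ⟨le_rfl, zero_le_one⟩, by norm_num⟩

theorem eta1_upper {a : ℝ → ℝ}
    (ha : ContinuousOn a (Icc 0 1)) (ha0 : ∀ r ∈ Icc (0:ℝ) 1, 0 ≤ a r)
    (hanv : ∀ s t : ℝ, 0 ≤ s → s < t → t ≤ 1 → ∃ r ∈ Ioo s t, a r ≠ 0)
    (β : ℝ) : ∃ H : ℝ, ∀ p, 2 ≤ p → p ≤ β → eta1 a p ≤ H := by
  by_cases hβ : 2 ≤ β
  swap
  · exact ⟨0, fun p h1 h2 => absurd (h1.trans h2) hβ⟩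
  set d := ∫ r in (0:ℝ)..1, r ^ β * a r * |(fun r : ℝ => 1 - r ^ 2) r| ^ β with hd
  have hd0 : 0 < d := denom_pos ha ha0 hanv (by linarith) (by linarith) c1_test.cont test_ne
  refine ⟨2 ^ β / d, fun p hp hpβ => ?_⟩
  refine (eta1_le ha0 hp c1_test (by simp) (by simp) test_ne).trans ?_
  have hN : (∫ r in (0:ℝ)..1, |(fun r : ℝ => -(2 * r)) r| ^ p) ≤ 2 ^ β := by
    have := intervalIntegral.integral_mono_on (μ := MeasureTheory.volume) zero_le_one
      (f := fun r => |(fun r : ℝ => -(2 * r)) r| ^ p)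
      ((c1_test.cont'.abs.rpow_const fun _ _ => Or.inr (by linarith)).intervalIntegrable_of_Icc
        zero_le_one)
      (intervalIntegrable_const (c := (2:ℝ) ^ β))
      (by
        intro r hr
        beta_reduce
        rw [abs_neg, abs_of_nonneg (by linarith [hr.1])]
        calc (2 * r) ^ p ≤ 2 ^ p :=
              Real.rpow_le_rpow (by linarith [hr.1]) (by linarith [hr.2]) (by linarith)
          _ ≤ 2 ^ β := Real.rpow_le_rpow_of_exponent_le (by norm_num) hpβ)
    simpa using this
  have hD : d ≤ ∫ r in (0:ℝ)..1, r ^ (p - 2) * a r * |(fun r : ℝ => 1 - r ^ 2) r| ^ p := by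
    have hc : ∀ e q : ℝ, 0 ≤ e → 0 ≤ q →
        ContinuousOn (fun r => r ^ e * a r * |(fun r : ℝ => 1 - r ^ 2) r| ^ q) (Icc 0 1) :=
      fun e q he hq => ((continuousOn_id.rpow_const fun _ _ => Or.inr he).mul ha).mul
        (c1_test.cont.abs.rpow_const fun _ _ => Or.inr hq)
    refine intervalIntegral.integral_mono_on zero_le_one
      ((hc β β (by linarith) (by linarith)).intervalIntegrable_of_Icc zero_le_one)
      ((hc (p - 2) p (by linarith) (by linarith)).intervalIntegrable_of_Icc zero_le_one) ?_
    intro r hr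
    have h1 := ha0 r hr
    have h2 := hr.1
    have h3 := hr.2
    have h4 : |1 - r ^ 2| ≤ 1 := by rw [abs_le]; constructor <;> nlinarith
    have h5 : r ^ β ≤ r ^ (p - 2) := by
      rcases h2.eq_or_lt with e | e
      · rw [← e, Real.zero_rpow (by linarith)]; positivity
      · exact Real.rpow_le_rpow_of_exponent_ge e h3 (by linarith)
    have h6 : |1 - r ^ 2| ^ β ≤ |1 - r ^ 2| ^ p := by
      rcases (abs_nonneg (1 - r ^ 2)).eq_or_lt with e | e
      · rw [← e, Real.zero_rpow (by linarith)]; positivity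
      · exact Real.rpow_le_rpow_of_exponent_ge e h4 hpβ
    beta_reduce
    gcongr
  have hD' : d ≤ (p - 1) * ∫ r in (0:ℝ)..1, r ^ (p - 2) * a r * |(fun r : ℝ => 1 - r ^ 2) r| ^ p := by
    nlinarith
  gcongr

theorem power_diff {q m μ : ℝ} (hq : 1 ≤ q) (hm : 0 ≤ m) (hmu : m < μ) :
    μ ^ q - m ^ q ≤ q * μ ^ (q - 1) * (μ - m) := by
  have hμ : 0 < μ := by linarith
  have h1 := one_add_mul_self_le_rpow_one_add (s := (m - μ) / μ) (p := q)
    (by rw [le_div_iff₀ hμ]; linarith) hq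
  have h2 : m ^ q = μ ^ q * (1 + (m - μ) / μ) ^ q := by
    have h3 : 1 + (m - μ) / μ = m / μ := by field_simp; ring
    rw [h3, ← Real.mul_rpow hμ.le (by positivity)]; congr 1; field_simp
  have h4 : μ ^ q = μ ^ (q - 1) * μ := by rw [← Real.rpow_add_one hμ.ne']; congr 1; ring
  have h5 : μ ^ q * (1 + q * ((m - μ) / μ)) ≤ m ^ q := by rw [h2]; gcongr
  have h6 : μ ^ q * (1 + q * ((m - μ) / μ)) = μ ^ q - q * μ ^ (q - 1) * (μ - m) := by
    rw [h4]; field_simp; ring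
  linarith

/-- A nontrivial solution with `μ > μ₁` has a quantitative gap. -/
theorem eig_gap {a : ℝ → ℝ}
    (ha : ContinuousOn a (Icc 0 1)) (ha0 : ∀ r ∈ Icc (0:ℝ) 1, 0 ≤ a r)
    (hanv : ∀ s t : ℝ, 0 ≤ s → s < t → t ≤ 1 → ∃ r ∈ Ioo s t, a r ≠ 0)
    {A : ℝ} (hA : 0 < A) (haA : ∀ r ∈ Icc (0:ℝ) 1, a r ≤ A) {p lam : ℝ} (hp : 2 ≤ p)
    (hlam : eta1 a p < lam) {v v' : ℝ → ℝ}
    (hs : Sol p (lam * (p - 1)) A (fun r => r ^ (p - 2) * a r) v v') (hv1 : v 1 = 0)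
    (hne : ∃ r ∈ Icc (0:ℝ) 1, v r ≠ 0) :
    eta1 a p ≤ lam - 1 / (2 * (lam * (p - 1)) * A ^ 2 * 2 ^ p) / (p - 1) := by
  have hp1 : 0 < p - 1 := by linarith
  have hv0 : v 0 ≠ 0 := by
    intro h0
    obtain ⟨r, hr, hvr⟩ := hne
    exact hvr (hs.unique h0 r hr)
  -- normalise
  have hs' := hs.smul (v 0)⁻¹
  set u : ℝ → ℝ := fun r => (v 0)⁻¹ * v r with hu
  set u' : ℝ → ℝ := fun r => (v 0)⁻¹ * v' r with hu'
  have hu0 : u 0 = 1 := inv_mul_cancel₀ hv0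
  have hu1 : u 1 = 0 := by simp [hu, hv1]
  -- first zero
  have hZc : IsCompact (Icc (0:ℝ) 1 ∩ u ⁻¹' {0}) :=
    isCompact_Icc.of_isClosed_subset
      (hs'.c1.cont.preimage_isClosed_of_isClosed isClosed_Icc isClosed_singleton)
      inter_subset_left
  obtain ⟨z, ⟨hzI, hz⟩, hzmin⟩ := hZc.exists_isLeast ⟨1, ⟨zero_le_one, le_rfl⟩, hu1⟩
  have hz' : u z = 0 := hz
  have hz0 : 0 < z := lt_of_le_of_ne hzI.1 (fun e => by rw [← e, hu0] at hz'; norm_num at hz')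
  have hpos : ∀ r ∈ Ico (0:ℝ) z, 0 < u r := by
    intro r hr
    by_contra hcon
    push Not at hcon
    obtain ⟨c, hc, hc0⟩ := intermediate_value_Icc' hr.1
      (hs'.c1.cont.mono (Icc_subset_Icc le_rfl (hr.2.le.trans hzI.2)))
      (show (0:ℝ) ∈ Icc (u r) (u 0) from ⟨hcon, by rw [hu0]; exact zero_le_one⟩)
    have := hzmin ⟨⟨hc.1, hc.2.trans (hr.2.le.trans hzI.2)⟩, hc0⟩
    linarith [hc.2, hr.2]
  have hkc := hs.kc
  rcases hzI.2.eq_or_lt with e | hz1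
  · -- no interior zero: Picone
    exfalso
    rw [e] at hpos
    refine absurd hlam (not_lt.mpr ?_)
    refine le_csInf ⟨_, _, _, c1_test.cont', c1_test.der, by simp, by simp, test_ne, rfl⟩ ?_
    rintro q ⟨w, w', hw', hw, -, hw1, hwne, rfl⟩
    have hC : C1 w w' := ⟨hw', hw⟩
    have hX := denom_pos ha ha0 hanv (by linarith : 0 ≤ p - 2) (by linarith : 0 ≤ p) hC.cont hwne
    have := hs'.picone hpos hu1 hC hw1
    rw [Sol.psi_int hp hkc hC] at this
    rw [le_div_iff₀ (by positivity)]
    linarith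
  · obtain ⟨w, w', hC, hw0, hw1, hwne, hN⟩ := hs'.gap hz0 hz1 hpos hz' hu0 hu1
    have hwne' : ∃ r ∈ Icc (0:ℝ) 1, w r ≠ 0 := ⟨0, ⟨le_rfl, zero_le_one⟩, hwne⟩
    have hX := denom_pos ha ha0 hanv (by linarith : 0 ≤ p - 2) (by linarith : 0 ≤ p) hC.cont hwne'
    refine (eta1_le ha0 hp hC hw0 hw1 hwne').trans ?_
    rw [div_le_iff₀ (by positivity)]
    refine hN.trans (le_of_eq ?_)
    field_simp

theorem stmt6 (a : ℝ → ℝ)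
    (ha : ContinuousOn a (Icc 0 1)) (ha0 : ∀ r ∈ Icc (0:ℝ) 1, 0 ≤ a r)
    (hanv : ∀ s t : ℝ, 0 ≤ s → s < t → t ≤ 1 → ∃ r ∈ Ioo s t, a r ≠ 0) :
    ∀ α β : ℝ, 2 ≤ α → α ≤ β →
      ∃ δ > (0:ℝ), ∀ p ∈ Icc α β, ∀ μ : ℝ, mu1 a p < μ → μ ≤ mu1 a p + δ →
        ∀ v v' : ℝ → ℝ, APSol p μ a v v' → ∀ r ∈ Icc (0:ℝ) 1, v r = 0 := by
  intro α β hα hαβ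
  obtain ⟨A0, hA0⟩ := isCompact_Icc.exists_bound_of_continuousOn ha
  obtain ⟨A, hA1, haA⟩ : ∃ A : ℝ, 0 < A ∧ ∀ r ∈ Icc (0:ℝ) 1, a r ≤ A :=
    ⟨max A0 1, by positivity, fun r hr =>
      ((le_abs_self _).trans (hA0 r hr)).trans (le_max_left _ _)⟩
  obtain ⟨H, hH⟩ := eta1_upper ha ha0 hanv β
  set B := max H 1 with hB
  have hB1 : 1 ≤ B := le_max_right _ _
  set Λ := (B + 1) ^ β with hΛ
  have hΛ0 : 0 < Λ := by positivity
  have hβ : 2 ≤ β := hα.trans hαβ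
  set κ := 1 / (2 * (Λ * β) * A ^ 2 * 2 ^ β) / β with hκ
  have hκ0 : 0 < κ := by positivity
  refine ⟨min 1 (κ / (2 * β * Λ)), by positivity, ?_⟩
  intro p hpI μ hμ1 hμ2 v v' hsol
  have hp : 2 ≤ p := hα.trans hpI.1
  have hpβ : p ≤ β := hpI.2
  have hp1 : 0 < p - 1 := by linarith
  have hη0 := eta1_nonneg ha0 hp
  have hm0 : 0 ≤ mu1 a p := Real.rpow_nonneg hη0 _
  have hμ0 : 0 < μ := hm0.trans_lt hμ1
  have hmη : mu1 a p ^ (p - 1) = eta1 a p := by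
    unfold mu1
    rw [← Real.rpow_mul hη0, one_div, inv_mul_cancel₀ hp1.ne', Real.rpow_one]
  have hmB : mu1 a p ≤ B := by
    calc mu1 a p ≤ B ^ (1 / (p - 1)) := by
          unfold mu1
          exact Real.rpow_le_rpow hη0 ((hH p hp hpβ).trans (le_max_left _ _)) (by positivity)
      _ ≤ B ^ (1:ℝ) := by
          apply Real.rpow_le_rpow_of_exponent_le hB1
          rw [div_le_one hp1]; linarith
      _ = B := Real.rpow_one B
  have hμB : μ ≤ B + 1 := by linarith [min_le_left 1 (κ / (2 * β * Λ))]
  have hpow : ∀ e : ℝ, 0 ≤ e → e ≤ β → μ ^ e ≤ Λ := fun e he heβ =>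
    (Real.rpow_le_rpow hμ0.le hμB he).trans
      (Real.rpow_le_rpow_of_exponent_le (by linarith) heβ)
  by_contra hcon
  push Not at hcon
  set lam := μ ^ (p - 1) with hlam
  have hlam0 : 0 < lam := Real.rpow_pos_of_pos hμ0 _
  have hlt : eta1 a p < lam := by
    rw [← hmη]; exact Real.rpow_lt_rpow hm0 hμ1 hp1
  obtain ⟨s1, s2, s3, s4, s5⟩ := hsol
  have hSol : Sol p (lam * (p - 1)) A (fun r => r ^ (p - 2) * a r) v v' :=
    { hp := hp
      hL := by positivity
      hA := hA1
      kc := (continuousOn_id.rpow_const fun _ _ => Or.inr (by linarith)).mul ha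
      k0 := fun r hr => mul_nonneg (Real.rpow_nonneg hr.1 _) (ha0 r hr)
      kA := fun r hr => by
        have h1 : r ^ (p - 2) ≤ 1 := Real.rpow_le_one hr.1 hr.2 (by linarith)
        have h2 := ha0 r hr
        have h3 := haA r hr
        have h4 : 0 ≤ r ^ (p - 2) := Real.rpow_nonneg hr.1 _
        nlinarith
      c1 := ⟨s1, s2⟩
      eq := fun r hr => (s3 r hr).congr_deriv (by unfold phi; ring)
      z0 := s4 }
  have hgap := eig_gap ha ha0 hanv hA1 haA hp hlt hSol s5 hcon
  have hκle : κ ≤ 1 / (2 * (lam * (p - 1)) * A ^ 2 * 2 ^ p) / (p - 1) := by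
    have h1 : lam ≤ Λ := hpow _ hp1.le (by linarith)
    have h2 : (2:ℝ) ^ p ≤ 2 ^ β := Real.rpow_le_rpow_of_exponent_le (by norm_num) hpβ
    have h3 : p - 1 ≤ β := by linarith
    rw [hκ]
    gcongr
  have hdiff := power_diff (q := p - 1) (by linarith) hm0 hμ1
  rw [hmη, ← hlam] at hdiff
  have hfin : (p - 1) * μ ^ (p - 1 - 1) * (μ - mu1 a p) ≤ κ / 2 := by
    have h1 : μ ^ (p - 1 - 1) ≤ Λ := hpow _ (by linarith) (by linarith)
    have h2 : p - 1 ≤ β := by linarith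
    have h3 : μ - mu1 a p ≤ κ / (2 * β * Λ) := by
      linarith [min_le_right 1 (κ / (2 * β * Λ))]
    have h4 : 0 ≤ μ - mu1 a p := by linarith
    calc (p - 1) * μ ^ (p - 1 - 1) * (μ - mu1 a p) ≤ β * Λ * (κ / (2 * β * Λ)) := by gcongr
      _ = κ / 2 := by
        have : β ≠ 0 := by linarith
        field_simp
  linarith
end

section
/- Let f : [0,∞) → [0,∞) be continuous with f(s) > 0 for all s > 0, and assume f₀ = 0 and f∞ = 0. Then there exists λ* > 0 such that for every λ ∈ (λ*, +∞) there exist two distinct functions v₁, v₂ ∈ C([0,1],[0,∞)), each satisfying v_i = λ T_f v_i and v_i(r) > 0 for all r ∈ (0,1); equivalently, the radial Monge–Ampère problem has at least two negative, strictly convex solutions. -/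
open Set Filter Topology intervalIntegral

/-- The operator `T_F v (r) = ∫_r^1 (∫_0^s N τ^{N-1} a(τ) F(v(τ)) dτ)^{1/N} ds`. -/
noncomputable def TF (N : ℕ) (a F v : ℝ → ℝ) (r : ℝ) : ℝ :=
  ∫ s in r..1, (∫ τ in (0:ℝ)..s, (N : ℝ) * τ ^ (N - 1) * a τ * F (v τ)) ^ ((1:ℝ) / N)

/-- The first eigenvalue `λ₁` of `v = λ T_{s ↦ s^N} v`, given by the Rayleigh quotient. -/
noncomputable def lam1 (N : ℕ) (a : ℝ → ℝ) : ℝ :=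
  (sInf { q : ℝ | ∃ v v' : ℝ → ℝ,
    ContinuousOn v' (Icc 0 1) ∧
    (∀ r ∈ Icc (0:ℝ) 1, HasDerivWithinAt v (v' r) (Icc 0 1) r) ∧
    v' 0 = 0 ∧ v 1 = 0 ∧ (∃ r ∈ Icc (0:ℝ) 1, v r ≠ 0) ∧
    q = (∫ r in (0:ℝ)..1, |v' r| ^ (N + 1)) /
        ((N : ℝ) * ∫ r in (0:ℝ)..1, r ^ (N - 1) * a r * |v r| ^ (N + 1)) }) ^ ((1:ℝ) / N)

section helpers

/-- inner power for the delayed problem -/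
noncomputable def PP (N : ℕ) (h g : ℝ → ℝ) (δ : ℝ) (v : ℝ → ℝ) (s : ℝ) : ℝ :=
  (∫ τ in (0:ℝ)..s, h τ * g (v (max (τ - δ) 0))) ^ ((1:ℝ) / N)

/-- solution of the (delayed) initial value problem -/
def Sol_s16 (N : ℕ) (h g : ℝ → ℝ) (lam δ d : ℝ) (v : ℝ → ℝ) : Prop :=
  Continuous v ∧ ∀ r ∈ Icc (0:ℝ) 1, v r = d - lam * ∫ s in (0:ℝ)..r, PP N h g δ v s

lemma int_le_const {p : ℝ → ℝ} (hp : Continuous p) {x y C : ℝ} (hxy : x ≤ y)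
    (H : ∀ t ∈ Icc x y, p t ≤ C) : ∫ t in x..y, p t ≤ C * (y - x) := by
  have := integral_mono_on hxy (hp.intervalIntegrable (μ := MeasureTheory.volume) x y)
    (continuous_const.intervalIntegrable x y : IntervalIntegrable (fun _ => C) MeasureTheory.volume x y) H
  simpa [mul_comm] using this

lemma const_le_int {p : ℝ → ℝ} (hp : Continuous p) {x y C : ℝ} (hxy : x ≤ y)
    (H : ∀ t ∈ Icc x y, C ≤ p t) : C * (y - x) ≤ ∫ t in x..y, p t := by
  have := integral_mono_on hxy
    (continuous_const.intervalIntegrable x y : IntervalIntegrable (fun _ => C) MeasureTheory.volume x y)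
    (hp.intervalIntegrable (μ := MeasureTheory.volume) x y) H
  simpa [mul_comm] using this

lemma inner_cont {h g v : ℝ → ℝ} (hh : Continuous h) (hg : Continuous g) (hv : Continuous v)
    (δ : ℝ) : Continuous (fun τ => h τ * g (v (max (τ - δ) 0))) := by fun_prop

lemma PP_cont {N : ℕ} {h g v : ℝ → ℝ} (hh : Continuous h) (hg : Continuous g)
    (hv : Continuous v) (δ : ℝ) : Continuous (PP N h g δ v) := by
  unfold PP
  refine Continuous.rpow_const ?_ (fun _ => Or.inr (by positivity))
  exact continuous_primitive (fun a b => (inner_cont hh hg hv δ).intervalIntegrable a b) 0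

lemma inner_nonneg {h g v : ℝ → ℝ} (h0 : ∀ x, 0 ≤ h x) (g0 : ∀ x, 0 ≤ g x) {δ s : ℝ}
    (hs : 0 ≤ s) : 0 ≤ ∫ τ in (0:ℝ)..s, h τ * g (v (max (τ - δ) 0)) :=
  integral_nonneg hs (fun _ _ => mul_nonneg (h0 _) (g0 _))

lemma PP_nonneg {N : ℕ} {h g v : ℝ → ℝ} (h0 : ∀ x, 0 ≤ h x) (g0 : ∀ x, 0 ≤ g x) {δ s : ℝ}
    (hs : 0 ≤ s) : 0 ≤ PP N h g δ v s :=
  Real.rpow_nonneg (inner_nonneg h0 g0 hs) _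

lemma PP_mono {N : ℕ} {h g v : ℝ → ℝ} (hh : Continuous h) (hg : Continuous g)
    (hv : Continuous v) (h0 : ∀ x, 0 ≤ h x) (g0 : ∀ x, 0 ≤ g x) {δ s t : ℝ}
    (hs : 0 ≤ s) (hst : s ≤ t) : PP N h g δ v s ≤ PP N h g δ v t := by
  refine Real.rpow_le_rpow (inner_nonneg h0 g0 hs) ?_ (by positivity)
  refine integral_mono_interval le_rfl hs hst ?_ ((inner_cont hh hg hv δ).intervalIntegrable _ _)
  exact Eventually.of_forall (fun _ => mul_nonneg (h0 _) (g0 _))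

lemma Sol_s16.zero {N : ℕ} {h g v : ℝ → ℝ} {lam δ d : ℝ} (S : Sol_s16 N h g lam δ d v) : v 0 = d := by
  have := S.2 0 (by simp)
  simpa using this

lemma Sol_s16.diff {N : ℕ} {h g v : ℝ → ℝ} {lam δ d : ℝ} (S : Sol_s16 N h g lam δ d v)
    (hh : Continuous h) (hg : Continuous g) {r t : ℝ} (hr : 0 ≤ r) (hrt : r ≤ t) (ht : t ≤ 1) :
    v r - v t = lam * ∫ s in r..t, PP N h g δ v s := by
  have hc := PP_cont (N := N) hh hg S.1 δ
  rw [S.2 r ⟨hr, hrt.trans ht⟩, S.2 t ⟨hr.trans hrt, ht⟩,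
    ← integral_add_adjacent_intervals (hc.intervalIntegrable 0 r) (hc.intervalIntegrable r t)]
  ring

lemma Sol_s16.anti {N : ℕ} {h g v : ℝ → ℝ} {lam δ d : ℝ} (S : Sol_s16 N h g lam δ d v)
    (hh : Continuous h) (hg : Continuous g) (h0 : ∀ x, 0 ≤ h x) (g0 : ∀ x, 0 ≤ g x)
    (hl : 0 < lam) {r t : ℝ} (hr : 0 ≤ r) (hrt : r ≤ t) (ht : t ≤ 1) : v t ≤ v r := by
  have := S.diff hh hg hr hrt ht
  have h2 : 0 ≤ ∫ s in r..t, PP N h g δ v s :=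
    integral_nonneg hrt (fun s hs => PP_nonneg h0 g0 (hr.trans hs.1))
  nlinarith [mul_nonneg hl.le h2]

lemma Sol_s16.conc {N : ℕ} {h g v : ℝ → ℝ} {lam δ d : ℝ} (S : Sol_s16 N h g lam δ d v)
    (hh : Continuous h) (hg : Continuous g) (h0 : ∀ x, 0 ≤ h x) (g0 : ∀ x, 0 ≤ g x)
    (hl : 0 < lam) (h1 : 0 ≤ v 1) {r : ℝ} (hr : 0 ≤ r) (hr1 : r ≤ 1) : d * (1 - r) ≤ v r := by
  have e1 := S.diff hh hg le_rfl hr hr1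
  have e2 := S.diff hh hg hr hr1 le_rfl
  have hc := PP_cont (N := N) hh hg S.1 δ
  have i1 := int_le_const hc hr (C := PP N h g δ v r)
    (fun t ht => PP_mono hh hg S.1 h0 g0 ht.1 ht.2)
  have i2 := const_le_int hc hr1 (C := PP N h g δ v r)
    (fun t ht => PP_mono hh hg S.1 h0 g0 hr ht.1)
  rw [S.zero] at e1
  have j1 := mul_le_mul_of_nonneg_left i1 hl.le
  have j2 := mul_le_mul_of_nonneg_left i2 hl.le
  rw [← e1] at j1
  rw [← e2] at j2
  have k1 := mul_le_mul_of_nonneg_left j1 (sub_nonneg.2 hr1)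
  have k2 := mul_le_mul_of_nonneg_left j2 hr
  nlinarith [mul_nonneg hr h1]

lemma PP_le {N : ℕ} {h g v : ℝ → ℝ} (hh : Continuous h) (hg : Continuous g)
    (hv : Continuous v) (h0 : ∀ x, 0 ≤ h x) (g0 : ∀ x, 0 ≤ g x) {δ d H B : ℝ} (hδ : 0 ≤ δ)
    (hH : ∀ x, h x ≤ H) (hB : ∀ x ≤ d, g x ≤ B)
    (hvd : ∀ r ∈ Icc (0:ℝ) 1, v r ≤ d) {s : ℝ} (hs : s ∈ Icc (0:ℝ) 1) :
    PP N h g δ v s ≤ (H * B) ^ ((1:ℝ) / N) := by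
  have hH0 : 0 ≤ H := (h0 0).trans (hH 0)
  have hB0 : 0 ≤ B := (g0 d).trans (hB d le_rfl)
  refine Real.rpow_le_rpow (inner_nonneg h0 g0 hs.1) ?_ (by positivity)
  have := int_le_const (inner_cont hh hg hv δ) hs.1 (C := H * B) (fun t ht => by
    refine mul_le_mul (hH _) (hB _ (hvd _ ⟨le_max_right _ _, ?_⟩)) (g0 _) hH0
    have := hs.2
    have := ht.2
    exact max_le (by linarith) (by norm_num))
  have h3 := hs.2
  nlinarith [mul_nonneg hH0 hB0]

lemma Sol_s16.le {N : ℕ} {h g v : ℝ → ℝ} {lam δ d : ℝ} (S : Sol_s16 N h g lam δ d v)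
    (hh : Continuous h) (hg : Continuous g) (h0 : ∀ x, 0 ≤ h x) (g0 : ∀ x, 0 ≤ g x)
    (hl : 0 < lam) : ∀ r ∈ Icc (0:ℝ) 1, v r ≤ d := fun r hr => by
  have := S.anti hh hg h0 g0 hl le_rfl hr.1 hr.2
  rwa [S.zero] at this

lemma Sol_s16.pos_end {N : ℕ} (hN : 1 ≤ N) {h g v : ℝ → ℝ} {lam δ d H B : ℝ}
    (S : Sol_s16 N h g lam δ d v) (hδ : 0 ≤ δ) (hd : 0 < d)
    (hh : Continuous h) (hg : Continuous g) (h0 : ∀ x, 0 ≤ h x) (g0 : ∀ x, 0 ≤ g x)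
    (hl : 0 < lam) (hH : ∀ x, h x ≤ H) (hB : ∀ x ≤ d, g x ≤ B)
    (hb : H * B < (d / lam) ^ N) : 0 < v 1 := by
  have hc := PP_cont (N := N) hh hg S.1 δ
  have e1 := S.diff hh hg le_rfl zero_le_one le_rfl
  rw [S.zero] at e1
  have hH0 : 0 ≤ H := (h0 0).trans (hH 0)
  have hB0 : 0 ≤ B := (g0 d).trans (hB d le_rfl)
  have i1 := int_le_const hc zero_le_one (fun t ht =>
    PP_le hh hg S.1 h0 g0 hδ hH hB (S.le hh hg h0 g0 hl) ht)
  have i2 : (H * B) ^ ((1:ℝ) / N) < d / lam := by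
    have hN' : (0:ℝ) < 1 / N := by positivity
    have := Real.rpow_lt_rpow (by positivity) hb hN'
    rw [one_div, Real.pow_rpow_inv_natCast (by positivity) (by omega)] at this
    rwa [one_div]
  have i3 : lam * ∫ s in (0:ℝ)..1, PP N h g δ v s < lam * (d / lam) :=
    mul_lt_mul_of_pos_left (by linarith) hl
  rw [mul_div_cancel₀ _ hl.ne'] at i3
  linarith

lemma Sol_s16.neg_end {N : ℕ} {h g v : ℝ → ℝ} {lam δ m : ℝ}
    (S : Sol_s16 N h g lam δ 1 v) (hδ : 0 ≤ δ)
    (hh : Continuous h) (hg : Continuous g) (h0 : ∀ x, 0 ≤ h x) (g0 : ∀ x, 0 ≤ g x)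
    (hl : 0 < lam) (hm : ∀ x ∈ Icc (1/2:ℝ) 1, m ≤ g x) (hm0 : 0 ≤ m)
    (hb : 2 < lam * (m * ∫ τ in (0:ℝ)..(1/2), h τ) ^ ((1:ℝ) / N)) : v 1 < 0 := by
  by_contra! hcon
  have hc := PP_cont (N := N) hh hg S.1 δ
  have e1 := S.diff hh hg (r := 1/2) (t := 1) (by norm_num) (by norm_num) le_rfl
  have e0 := S.le hh hg h0 g0 hl (1/2) (by norm_num)
  have key : (m * ∫ τ in (0:ℝ)..(1/2), h τ) ^ ((1:ℝ) / N) ≤ PP N h g δ v (1/2) := by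
    refine Real.rpow_le_rpow (mul_nonneg hm0 (integral_nonneg (by norm_num) fun _ _ => h0 _)) ?_
      (by positivity)
    rw [← integral_const_mul]
    refine integral_mono_on (by norm_num) ((hh.const_mul m).intervalIntegrable _ _)
      ((inner_cont hh hg S.1 δ).intervalIntegrable _ _) ?_
    intro t ht
    rw [mul_comm]
    refine mul_le_mul_of_nonneg_left (hm _ ?_) (h0 _)
    have a1 : 0 ≤ max (t - δ) 0 := le_max_right _ _
    have a2 : max (t - δ) 0 ≤ 1/2 := max_le (by linarith [ht.2]) (by norm_num)
    refine ⟨?_, S.le hh hg h0 g0 hl _ ⟨a1, by linarith⟩⟩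
    have := S.conc hh hg h0 g0 hl hcon a1 (by linarith)
    linarith
  have i2 := const_le_int hc (x := 1/2) (y := 1) (by norm_num) (C := PP N h g δ v (1/2))
    (fun t ht => PP_mono hh hg S.1 h0 g0 (by norm_num) ht.1)
  have i3 := mul_le_mul_of_nonneg_left i2 hl.le
  have i4 := mul_le_mul_of_nonneg_left key hl.le
  rw [← e1] at i3
  nlinarith

/-- iterates -/
noncomputable def itn (N : ℕ) (h g : ℝ → ℝ) (lam δ : ℝ) : ℕ → ℝ → ℝ → ℝ
  | 0, d, _ => d
  | k + 1, d, r => d - lam * ∫ s in (0:ℝ)..r, PP N h g δ (itn N h g lam δ k d) s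

lemma itn_cont {N : ℕ} {h g : ℝ → ℝ} (hh : Continuous h) (hg : Continuous g) (lam δ : ℝ) (k : ℕ) :
    Continuous (fun p : ℝ × ℝ => itn N h g lam δ k p.1 p.2) := by
  induction k with
  | zero => exact continuous_fst
  | succ k ih =>
    simp only [itn]
    refine continuous_fst.sub (continuous_const.mul ?_)
    refine continuous_parametric_intervalIntegral_of_continuous
      (f := fun (p : ℝ × ℝ) s => PP N h g δ (itn N h g lam δ k p.1) s) ?_ continuous_snd
    unfold PP Function.uncurry
    refine Continuous.rpow_const ?_ (fun _ => Or.inr (by positivity))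
    refine continuous_parametric_intervalIntegral_of_continuous
      (f := fun (q : (ℝ × ℝ) × ℝ) τ => h τ * g (itn N h g lam δ k q.1.1 (max (τ - δ) 0))) ?_
      continuous_snd
    unfold Function.uncurry
    have : Continuous fun q : ((ℝ × ℝ) × ℝ) × ℝ =>
        itn N h g lam δ k q.1.1.1 (max (q.2 - δ) 0) :=
      ih.comp (f := fun q : ((ℝ × ℝ) × ℝ) × ℝ => (q.1.1.1, max (q.2 - δ) 0)) (by fun_prop)
    fun_prop

lemma itn_stab {N : ℕ} {h g : ℝ → ℝ} {lam δ : ℝ} (hδ : 0 ≤ δ) (d : ℝ) (k : ℕ) :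
    ∀ r, 0 ≤ r → r ≤ k * δ → itn N h g lam δ (k+1) d r = itn N h g lam δ k d r := by
  induction k with
  | zero =>
    intro r h0 h1
    have : r = 0 := by push_cast at h1; linarith
    subst this
    simp [itn]
  | succ k ih =>
    intro r h0 h1
    rw [itn, itn]
    congr 2
    refine integral_congr fun s hs => ?_
    rw [uIcc_of_le h0] at hs
    simp only [PP]
    congr 1
    refine integral_congr fun t ht => ?_
    rw [uIcc_of_le hs.1] at ht
    show _ = _
    rw [ih _ (le_max_right _ _)]
    push_cast at h1
    refine max_le (by linarith [ht.2, hs.2]) (by positivity)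

lemma itn_sol {N : ℕ} {h g : ℝ → ℝ} (hh : Continuous h) (hg : Continuous g) (lam : ℝ) (n : ℕ)
    (d : ℝ) : Sol_s16 N h g lam (1 / ((n:ℝ) + 1)) d (itn N h g lam (1 / ((n:ℝ) + 1)) (n+1) d) := by
  have hp : (0:ℝ) < n + 1 := by positivity
  have hc : Continuous (fun r : ℝ => (d, r)) := by fun_prop
  refine ⟨(itn_cont (N := N) hh hg lam (1 / ((n:ℝ) + 1)) (n+1)).comp hc, fun r hr => ?_⟩
  rw [← itn_stab (by positivity) d (n+1) r hr.1 ?_, itn]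
  push_cast
  rw [mul_one_div_cancel hp.ne']
  exact hr.2

/-- compactness -/
lemma limit_sol {N : ℕ} {h g : ℝ → ℝ} (hh : Continuous h) (hg : Continuous g)
    (h0 : ∀ x, 0 ≤ h x) (g0 : ∀ x, 0 ≤ g x) {lam H B l u : ℝ} (hl : 0 < lam)
    (hH : ∀ x, h x ≤ H) (hB : ∀ x ≤ u, g x ≤ B) (d : ℕ → ℝ) (v : ℕ → ℝ → ℝ)
    (hd : ∀ n, d n ∈ Icc l u) (S : ∀ n : ℕ, Sol_s16 N h g lam (1 / ((n:ℝ) + 1)) (d n) (v n))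
    (hv1 : ∀ n, v n 1 = 0) :
    ∃ D ∈ Icc l u, ∃ w, Sol_s16 N h g lam 0 D w ∧ w 1 = 0 := by
  have hH0 : 0 ≤ H := (h0 0).trans (hH 0)
  have hB0 : 0 ≤ B := (g0 u).trans (hB u le_rfl)
  have hδ : ∀ n : ℕ, (0:ℝ) ≤ 1 / ((n:ℝ) + 1) := fun n => by positivity
  have hvu : ∀ n, ∀ r ∈ Icc (0:ℝ) 1, v n r ≤ u := fun n r hr =>
    ((S n).le hh hg h0 g0 hl r hr).trans (hd n).2
  have hv0 : ∀ n, ∀ r ∈ Icc (0:ℝ) 1, 0 ≤ v n r := fun n r hr => by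
    rw [← hv1 n]; exact (S n).anti hh hg h0 g0 hl hr.1 hr.2 le_rfl
  have hPP : ∀ n : ℕ, ∀ s ∈ Icc (0:ℝ) 1, PP N h g (1 / ((n:ℝ) + 1)) (v n) s ≤ (H * B) ^ ((1:ℝ) / N) :=
    fun n s hs => PP_le hh hg (S n).1 h0 g0 (hδ n) hH hB (hvu n) hs
  set M := (H * B) ^ ((1:ℝ) / N) with hM
  have hM0 : 0 ≤ M := by positivity
  let A : Set (BoundedContinuousFunction (Icc (0:ℝ) 1) ℝ) :=
    {F | (∀ x, F x ∈ Icc 0 u) ∧ ∀ x y, dist (F x) (F y) ≤ lam * M * dist x y}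
  let V : ℕ → BoundedContinuousFunction (Icc (0:ℝ) 1) ℝ := fun n =>
    BoundedContinuousFunction.mkOfCompact ⟨fun x => v n x, (S n).1.comp continuous_subtype_val⟩
  have hVA : ∀ n, V n ∈ A := by
    intro n
    refine ⟨fun x => ⟨hv0 n x x.2, hvu n x x.2⟩, ?_⟩
    have main : ∀ x y : Icc (0:ℝ) 1, (x:ℝ) ≤ y → dist (V n x) (V n y) ≤ lam * M * dist x y := by
      intro x y hxy
      have e := (S n).diff hh hg x.2.1 hxy y.2.2
      have e2 := (S n).anti hh hg h0 g0 hl x.2.1 hxy y.2.2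
      change dist (v n x) (v n y) ≤ lam * M * dist (x:ℝ) y
      rw [Real.dist_eq, abs_of_nonneg (by linarith), dist_comm, Real.dist_eq,
        abs_of_nonneg (by linarith), e, mul_assoc]
      refine mul_le_mul_of_nonneg_left ?_ hl.le
      exact int_le_const (PP_cont hh hg (S n).1 _) hxy (fun t ht =>
        hPP n t ⟨x.2.1.trans ht.1, ht.2.trans y.2.2⟩)
    intro x y
    rcases le_total (x:ℝ) y with hxy | hxy
    · exact main x y hxy
    · rw [dist_comm, dist_comm x]; exact main y x hxy
  have hcomp : IsCompact (closure A) := by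
    refine BoundedContinuousFunction.arzela_ascoli (Icc 0 u) isCompact_Icc A
      (fun F x hF => hF.1 x) ?_
    refine Metric.equicontinuous_of_continuity_modulus (fun t => lam * M * t) ?_ _ ?_
    · have : Continuous fun t : ℝ => lam * M * t := by fun_prop
      simpa using this.tendsto 0
    · intro x y F
      exact F.2.2 x y
  obtain ⟨W, -, φ, hφ, hlim⟩ := hcomp.tendsto_subseq (fun n => subset_closure (hVA n))
  let w : ℝ → ℝ := fun r => W (projIcc 0 1 zero_le_one r)
  have hw : Continuous w := W.continuous.comp continuous_projIcc
  have hev : ∀ (x : ℕ → ℝ) (y : ℝ), (∀ n, x n ∈ Icc (0:ℝ) 1) → Tendsto x atTop (𝓝 y) →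
      Tendsto (fun n => v (φ n) (x n)) atTop (𝓝 (w y)) := by
    intro x y hx hxy
    have h1 : Tendsto (fun n => projIcc (0:ℝ) 1 zero_le_one (x n)) atTop
      (𝓝 (projIcc 0 1 zero_le_one y)) := (continuous_projIcc.tendsto y).comp hxy
    have h2 := ((continuous_eval (F := BoundedContinuousFunction (Icc (0:ℝ) 1) ℝ)).tendsto
      (W, projIcc 0 1 zero_le_one y)).comp (hlim.prodMk_nhds h1)
    refine h2.congr fun n => ?_
    change v (φ n) ((projIcc (0:ℝ) 1 zero_le_one (x n) : Icc (0:ℝ) 1) : ℝ) = _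
    rw [projIcc_of_mem _ (hx n)]
  have hev' : ∀ y ∈ Icc (0:ℝ) 1, Tendsto (fun n => v (φ n) y) atTop (𝓝 (w y)) := fun y hy =>
    hev (fun _ => y) y (fun _ => hy) tendsto_const_nhds
  have hdl : Tendsto (fun n => d (φ n)) atTop (𝓝 (w 0)) :=
    (hev' 0 (by simp)).congr fun n => (S _).zero
  have hδl : Tendsto (fun n => 1 / ((φ n : ℝ) + 1)) atTop (𝓝 0) :=
    (tendsto_one_div_add_atTop_nhds_zero_nat (𝕜 := ℝ)).comp hφ.tendsto_atTop
  have hPl : ∀ s ∈ Icc (0:ℝ) 1, Tendsto (fun n => PP N h g (1 / ((φ n : ℝ) + 1)) (v (φ n)) s) atTop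
      (𝓝 (PP N h g 0 w s)) := by
    intro s hs
    unfold PP
    refine ((Real.continuous_rpow_const (by positivity)).tendsto _).comp ?_
    refine tendsto_integral_filter_of_dominated_convergence (fun _ => H * B) ?_ ?_ ?_ ?_
    · exact Eventually.of_forall fun n => (inner_cont hh hg (S _).1 _).aestronglyMeasurable
    · refine Eventually.of_forall fun n => Eventually.of_forall fun t ht => ?_
      rw [uIoc_of_le hs.1] at ht
      rw [Real.norm_of_nonneg (mul_nonneg (h0 _) (g0 _))]
      refine mul_le_mul (hH _) (hB _ (hvu _ _ ⟨le_max_right _ _, ?_⟩)) (g0 _) hH0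
      exact max_le (by linarith [ht.2, hs.2, hδ (φ n)]) (by norm_num)
    · exact continuous_const.intervalIntegrable _ _
    · refine Eventually.of_forall fun t ht => ?_
      rw [uIoc_of_le hs.1] at ht
      refine Tendsto.const_mul _ ((hg.tendsto _).comp ?_)
      refine hev _ _ (fun n => ⟨le_max_right _ _, ?_⟩) ?_
      · exact max_le (by linarith [ht.2, hs.2, hδ (φ n)]) (by norm_num)
      · exact (tendsto_const_nhds.sub hδl).max tendsto_const_nhds
  refine ⟨w 0, isClosed_Icc.mem_of_tendsto hdl (Eventually.of_forall fun n => hd _), w, ⟨hw, ?_⟩, ?_⟩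
  · intro r hr
    refine tendsto_nhds_unique (hev' r hr) ?_
    have : Tendsto (fun n => d (φ n) - lam * ∫ s in (0:ℝ)..r, PP N h g (1 / ((φ n : ℝ) + 1)) (v (φ n)) s)
        atTop (𝓝 (w 0 - lam * ∫ s in (0:ℝ)..r, PP N h g 0 w s)) := by
      refine hdl.sub (Tendsto.const_mul _ ?_)
      refine tendsto_integral_filter_of_dominated_convergence (fun _ => M) ?_ ?_ ?_ ?_
      · exact Eventually.of_forall fun n => (PP_cont hh hg (S _).1 _).aestronglyMeasurable
      · refine Eventually.of_forall fun n => Eventually.of_forall fun t ht => ?_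
        rw [uIoc_of_le hr.1] at ht
        rw [Real.norm_of_nonneg (PP_nonneg h0 g0 ht.1.le)]
        exact hPP _ _ ⟨ht.1.le, ht.2.trans hr.2⟩
      · exact continuous_const.intervalIntegrable _ _
      · refine Eventually.of_forall fun t ht => ?_
        rw [uIoc_of_le hr.1] at ht
        exact hPl t ⟨ht.1.le, ht.2.trans hr.2⟩
    exact this.congr fun n => ((S _).2 r hr).symm
  · exact tendsto_nhds_unique (hev' 1 (by simp)) (by simp [hv1])

/-- shooting between two parameters with opposite end signs -/
lemma shoot {N : ℕ} {h g : ℝ → ℝ} (hh : Continuous h) (hg : Continuous g)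
    (h0 : ∀ x, 0 ≤ h x) (g0 : ∀ x, 0 ≤ g x) {lam H B l u : ℝ} (hl : 0 < lam) (hlu : l ≤ u)
    (hH : ∀ x, h x ≤ H) (hB : ∀ x ≤ u, g x ≤ B)
    (hs : (∀ δ v, 0 ≤ δ → Sol_s16 N h g lam δ l v → 0 ≤ v 1) ∧
          (∀ δ v, 0 ≤ δ → Sol_s16 N h g lam δ u v → v 1 ≤ 0) ∨
          (∀ δ v, 0 ≤ δ → Sol_s16 N h g lam δ l v → v 1 ≤ 0) ∧
          (∀ δ v, 0 ≤ δ → Sol_s16 N h g lam δ u v → 0 ≤ v 1)) :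
    ∃ D ∈ Icc l u, ∃ w, Sol_s16 N h g lam 0 D w ∧ w 1 = 0 := by
  have hδ : ∀ n : ℕ, (0:ℝ) ≤ 1 / ((n:ℝ) + 1) := fun n => by positivity
  have hex : ∀ n : ℕ, ∃ d ∈ Icc l u, itn N h g lam (1 / ((n:ℝ) + 1)) (n+1) d 1 = 0 := by
    intro n
    have hc : Continuous fun d => itn N h g lam (1 / ((n:ℝ) + 1)) (n+1) d 1 :=
      (itn_cont (N := N) hh hg lam (1 / ((n:ℝ) + 1)) (n+1)).comp
        (f := fun d => (d, (1:ℝ))) (by fun_prop)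
    rcases hs with ⟨ha, hb⟩ | ⟨ha, hb⟩
    · exact intermediate_value_Icc' hlu hc.continuousOn
        ⟨hb _ _ (hδ n) (itn_sol hh hg lam n u), ha _ _ (hδ n) (itn_sol hh hg lam n l)⟩
    · exact intermediate_value_Icc hlu hc.continuousOn
        ⟨ha _ _ (hδ n) (itn_sol hh hg lam n l), hb _ _ (hδ n) (itn_sol hh hg lam n u)⟩
  choose d hd hd1 using hex
  exact limit_sol hh hg h0 g0 hl hH hB d _ hd (fun n => itn_sol hh hg lam n (d n)) hd1

end helpers

theorem stmt16 (N : ℕ) (hN : 1 ≤ N) (a : ℝ → ℝ)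
    (ha : ContinuousOn a (Icc 0 1)) (ha0 : ∀ r ∈ Icc (0:ℝ) 1, 0 ≤ a r)
    (hanv : ∀ s t : ℝ, 0 ≤ s → s < t → t ≤ 1 → ∃ r ∈ Ioo s t, a r ≠ 0)
    (f : ℝ → ℝ) (hf : ContinuousOn f (Ici 0))
    (hfnonneg : ∀ s ≥ (0:ℝ), 0 ≤ f s) (hfpos : ∀ s > (0:ℝ), 0 < f s)
    (h0 : Tendsto (fun s => f s / s ^ N) (nhdsWithin 0 (Ioi 0)) (nhds 0))
    (hinf : Tendsto (fun s => f s / s ^ N) atTop (nhds 0)) :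
    ∃ lamStar : ℝ, 0 < lamStar ∧ ∀ lam : ℝ, lamStar < lam →
      ∃ v₁ v₂ : ℝ → ℝ, (∃ r ∈ Icc (0:ℝ) 1, v₁ r ≠ v₂ r) ∧
        (ContinuousOn v₁ (Icc 0 1) ∧ (∀ r ∈ Icc (0:ℝ) 1, 0 ≤ v₁ r) ∧
          (∀ r ∈ Ioo (0:ℝ) 1, 0 < v₁ r) ∧
          ∀ r ∈ Icc (0:ℝ) 1, v₁ r = lam * TF N a f v₁ r) ∧
        (ContinuousOn v₂ (Icc 0 1) ∧ (∀ r ∈ Icc (0:ℝ) 1, 0 ≤ v₂ r) ∧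
          (∀ r ∈ Ioo (0:ℝ) 1, 0 < v₂ r) ∧
          ∀ r ∈ Icc (0:ℝ) 1, v₂ r = lam * TF N a f v₂ r) := by
  have hNR : (0:ℝ) < N := by exact_mod_cast hN
  -- extended data
  let k : ℝ → ℝ := fun x => (N : ℝ) * x ^ (N - 1) * a x
  let h : ℝ → ℝ := fun τ => k (projIcc (0:ℝ) 1 zero_le_one τ)
  let g : ℝ → ℝ := fun x => f (max x 0)
  have hk : ContinuousOn k (Icc 0 1) := by
    refine ContinuousOn.mul ?_ ha
    fun_prop
  have hk0 : ∀ x ∈ Icc (0:ℝ) 1, 0 ≤ k x := fun x hx =>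
    mul_nonneg (mul_nonneg hNR.le (pow_nonneg hx.1 _)) (ha0 x hx)
  have hh : Continuous h :=
    hk.comp_continuous (continuous_subtype_val.comp continuous_projIcc) (fun x => Subtype.property _)
  have hhk : ∀ x ∈ Icc (0:ℝ) 1, h x = k x := fun x hx => by
    simp only [h]; rw [projIcc_of_mem _ hx]
  have h0' : ∀ x, 0 ≤ h x := fun x => hk0 _ (Subtype.property _)
  have hg : Continuous g := hf.comp_continuous (by fun_prop) (fun x => mem_Ici.2 (le_max_right _ _))
  have g0 : ∀ x, 0 ≤ g x := fun x => hfnonneg _ (le_max_right _ _)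
  have gf : ∀ x, 0 ≤ x → g x = f x := fun x hx => by simp only [g]; rw [max_eq_left hx]
  obtain ⟨H, hHpos, hH⟩ : ∃ H > 0, ∀ x, h x ≤ H := by
    obtain ⟨C, hC⟩ := isCompact_Icc.bddAbove_image hk
    refine ⟨max C 1, by positivity, fun x => ?_⟩
    exact (hC (mem_image_of_mem _ (Subtype.property _))).trans (le_max_left _ _)
  have gB : ∀ u, ∃ B, ∀ x ≤ u, g x ≤ B := by
    intro u
    obtain ⟨C, hC⟩ := (isCompact_Icc (a := (0:ℝ)) (b := max u 0)).bddAbove_image hg.continuousOn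
    refine ⟨C, fun x hx => ?_⟩
    have : g x = g (max x 0) := by simp [g]
    rw [this]
    exact hC (mem_image_of_mem _ ⟨le_max_right _ _, max_le_max_right _ hx⟩)
  have f00 : f 0 = 0 := by
    have t1 : Tendsto f (nhdsWithin 0 (Ioi 0)) (nhds (f 0)) :=
      (hf 0 (by simp)).mono_left (nhdsWithin_mono _ Ioi_subset_Ici_self)
    have t2 : Tendsto (fun s : ℝ => s ^ N) (nhdsWithin 0 (Ioi 0)) (nhds (0 ^ N)) :=
      ((continuous_pow N).tendsto 0).mono_left nhdsWithin_le_nhds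
    have t3 := h0.mul t2
    rw [zero_mul] at t3
    refine tendsto_nhds_unique t1 (t3.congr' ?_)
    filter_upwards [self_mem_nhdsWithin] with s hs
    exact div_mul_cancel₀ _ (pow_ne_zero _ (ne_of_gt hs))
  have hA : 0 < ∫ τ in (0:ℝ)..(1/2), h τ := by
    obtain ⟨r, hr, har⟩ := hanv 0 (1/2) le_rfl (by norm_num) (by norm_num)
    have hrI : r ∈ Icc (0:ℝ) 1 := ⟨hr.1.le, by linarith [hr.2]⟩
    refine intervalIntegral.integral_pos (by norm_num) hh.continuousOn (fun x _ => h0' x)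
      ⟨r, ⟨hr.1.le, hr.2.le⟩, ?_⟩
    rw [hhk r hrI]
    exact mul_pos (mul_pos hNR (pow_pos hr.1 _)) (lt_of_le_of_ne (ha0 r hrI) har.symm)
  obtain ⟨m, hm0, hm⟩ : ∃ m > 0, ∀ x ∈ Icc (1/2:ℝ) 1, m ≤ g x := by
    obtain ⟨x, hx, hmin⟩ := (isCompact_Icc (a := (1/2:ℝ)) (b := 1)).exists_isMinOn
      ⟨1, by norm_num⟩ hg.continuousOn
    refine ⟨g x, ?_, fun y hy => hmin hy⟩
    have : 0 < x := by linarith [hx.1]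
    rw [gf x this.le]
    exact hfpos x this
  set Q := (m * ∫ τ in (0:ℝ)..(1/2), h τ) ^ ((1:ℝ) / N) with hQ
  have hQ0 : 0 < Q := Real.rpow_pos_of_pos (mul_pos hm0 hA) _
  refine ⟨2 / Q, by positivity, fun lam hlam => ?_⟩
  have hl : 0 < lam := lt_trans (by positivity) hlam
  have hb : 2 < lam * Q := (div_lt_iff₀ hQ0).1 hlam
  have hneg : ∀ δ v, 0 ≤ δ → Sol_s16 N h g lam δ 1 v → v 1 < 0 := fun δ v hδ S =>
    S.neg_end hδ hh hg h0' g0 hl hm hm0.le hb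
  set ε := (1 / lam) ^ N / (2 * H) with hε
  have hε0 : 0 < ε := by positivity
  have hHε : ∀ d : ℝ, 0 < d → H * (ε * d ^ N) < (d / lam) ^ N := by
    intro d hd
    have e : H * (ε * d ^ N) = (d / lam) ^ N / 2 := by
      rw [hε, div_pow, div_pow, one_pow]; field_simp
    rw [e]
    have : 0 < (d / lam) ^ N := by positivity
    linarith
  -- small data
  obtain ⟨l, hl0, hl1, hsmall⟩ : ∃ l : ℝ, 0 < l ∧ l < 1 ∧ ∀ x ≤ l, g x ≤ ε * l ^ N := by
    have ev := h0.eventually (gt_mem_nhds hε0)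
    obtain ⟨η, hη, hs⟩ := mem_nhdsGT_iff_exists_Ioo_subset.1 ev
    have hη : 0 < η := hη
    refine ⟨min (η / 2) (1 / 2), by positivity, by
      exact lt_of_le_of_lt (min_le_right _ _) (by norm_num), fun x hx => ?_⟩
    rcases le_or_gt x 0 with hx0 | hx0
    · have : g x = 0 := by simp only [g]; rw [max_eq_right hx0, f00]
      rw [this]; positivity
    · rw [gf x hx0.le]
      have h1 : f x / x ^ N < ε := hs ⟨hx0, by linarith [min_le_left (η / 2) (1 / 2)]⟩
      rw [div_lt_iff₀ (by positivity)] at h1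
      refine h1.le.trans (mul_le_mul_of_nonneg_left ?_ hε0.le)
      exact pow_le_pow_left₀ hx0.le hx N
  -- large data
  obtain ⟨u, hu1, hlarge⟩ : ∃ u : ℝ, 1 < u ∧ ∀ x ≤ u, g x ≤ ε * u ^ N := by
    have ev := hinf.eventually (gt_mem_nhds hε0)
    obtain ⟨s, hs⟩ := eventually_atTop.1 ev
    obtain ⟨C, hC⟩ := gB (max s 1)
    refine ⟨max 2 (C / ε), lt_of_lt_of_le (by norm_num) (le_max_left _ _), fun x hx => ?_⟩
    set u := max 2 (C / ε)
    have hu1 : (1:ℝ) ≤ u := le_trans (by norm_num) (le_max_left _ _)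
    rcases le_or_gt x (max s 1) with hxs | hxs
    · refine (hC x hxs).trans ?_
      have h1 : C / ε ≤ u := le_max_right _ _
      rw [div_le_iff₀ hε0] at h1
      have h2 : u ≤ u ^ N := le_self_pow₀ hu1 (by omega)
      nlinarith
    · have hx0 : 0 < x := lt_of_lt_of_le one_pos ((le_max_right _ _).trans hxs.le)
      rw [gf x hx0.le]
      have h1 : f x / x ^ N < ε := hs x ((le_max_left _ _).trans hxs.le)
      rw [div_lt_iff₀ (by positivity)] at h1
      refine h1.le.trans (mul_le_mul_of_nonneg_left ?_ hε0.le)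
      exact pow_le_pow_left₀ hx0.le hx N
  have hpl : ∀ δ v, 0 ≤ δ → Sol_s16 N h g lam δ l v → 0 ≤ v 1 := fun δ v hδ S =>
    (S.pos_end hN hδ hl0 hh hg h0' g0 hl hH hsmall (hHε l hl0)).le
  have hpu : ∀ δ v, 0 ≤ δ → Sol_s16 N h g lam δ u v → 0 ≤ v 1 := fun δ v hδ S =>
    (S.pos_end hN hδ (by linarith) hh hg h0' g0 hl hH hlarge (hHε u (by linarith))).le
  obtain ⟨B1, hB1⟩ := gB 1
  obtain ⟨B2, hB2⟩ := gB u
  obtain ⟨D₁, hD₁, v₁, S₁, e₁⟩ := shoot hh hg h0' g0 hl hl1.le hH hB1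
    (Or.inl ⟨hpl, fun δ v hδ S => (hneg δ v hδ S).le⟩)
  obtain ⟨D₂, hD₂, v₂, S₂, e₂⟩ := shoot hh hg h0' g0 hl hu1.le hH hB2
    (Or.inr ⟨fun δ v hδ S => (hneg δ v hδ S).le, hpu⟩)
  have fin : ∀ D v, 0 < D → Sol_s16 N h g lam 0 D v → v 1 = 0 →
      (ContinuousOn v (Icc 0 1) ∧ (∀ r ∈ Icc (0:ℝ) 1, 0 ≤ v r) ∧
          (∀ r ∈ Ioo (0:ℝ) 1, 0 < v r) ∧
          ∀ r ∈ Icc (0:ℝ) 1, v r = lam * TF N a f v r) := by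
    intro D v hD S hv1
    have hc : ∀ r ∈ Icc (0:ℝ) 1, D * (1 - r) ≤ v r := fun r hr =>
      S.conc hh hg h0' g0 hl hv1.ge hr.1 hr.2
    have hv0 : ∀ r ∈ Icc (0:ℝ) 1, 0 ≤ v r := fun r hr =>
      (mul_nonneg hD.le (by linarith [hr.2])).trans (hc r hr)
    refine ⟨S.1.continuousOn, hv0, fun r hr =>
      (mul_pos hD (by linarith [hr.2])).trans_le (hc r ⟨hr.1.le, hr.2.le⟩), fun r hr => ?_⟩
    have e := S.diff hh hg hr.1 hr.2 le_rfl
    rw [hv1, sub_zero] at e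
    rw [e]
    congr 1
    unfold TF
    refine integral_congr fun s hs => ?_
    rw [uIcc_of_le hr.2] at hs
    have hs0 : 0 ≤ s := hr.1.trans hs.1
    show PP N h g 0 v s = _
    unfold PP
    congr 1
    refine integral_congr fun t ht => ?_
    rw [uIcc_of_le hs0] at ht
    have htI : t ∈ Icc (0:ℝ) 1 := ⟨ht.1, ht.2.trans hs.2⟩
    show h t * g (v (max (t - 0) 0)) = _
    rw [sub_zero, max_eq_left ht.1, gf _ (hv0 t htI), hhk t htI]
  refine ⟨v₁, v₂, ⟨0, by simp, ?_⟩, fin D₁ v₁ (by linarith [hD₁.1]) S₁ e₁,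
    fin D₂ v₂ (by linarith [hD₂.1]) S₂ e₂⟩
  rw [S₁.zero, S₂.zero]
  intro hDD
  have : D₁ = 1 := le_antisymm hD₁.2 (hDD ▸ hD₂.1)
  rw [this] at S₁
  exact absurd (hneg 0 v₁ le_rfl S₁) (by simp [e₁])
end

section
/- Let f : [0,∞) → [0,∞) be continuous with f(s) > 0 for all s > 0, and assume f₀ = 0 and f∞ = +∞ (i.e., f(s)/s^N → 0 as s → 0⁺ and f(s)/s^N → +∞ as s → +∞). Then for every λ ∈ (0, +∞) there exists v ∈ C([0,1],[0,∞)) with v(r) > 0 for all r ∈ (0,1) satisfying v = λ T_f v; equivalently, u = −v is a negative, strictly convex solution of the radial Monge–Ampère problem. -/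
open Set Filter Topology intervalIntegral

section Helpers

lemma aux_h_cont {q : ℝ → ℝ} (hq : Continuous q) {p : ℝ} (hp : 0 ≤ p) :
    Continuous (fun s => (∫ τ in (0:ℝ)..s, q τ) ^ p) := by
  have h1 : Continuous (fun s => ∫ τ in (0:ℝ)..s, q τ) :=
    intervalIntegral.continuous_primitive (fun a b => hq.intervalIntegrable a b) 0
  exact (Real.continuous_rpow_const hp).comp h1

lemma aux_h_mono {q : ℝ → ℝ} (hq : Continuous q) (hq0 : ∀ x, 0 ≤ q x) {p : ℝ} (hp : 0 ≤ p)
    {x y : ℝ} (hx : 0 ≤ x) (hxy : x ≤ y) :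
    (∫ τ in (0:ℝ)..x, q τ) ^ p ≤ (∫ τ in (0:ℝ)..y, q τ) ^ p := by
  apply Real.rpow_le_rpow
  · exact intervalIntegral.integral_nonneg hx (fun u _ => hq0 u)
  · have := intervalIntegral.integral_add_adjacent_intervals
      (hq.intervalIntegrable (μ := MeasureTheory.volume) 0 x)
      (hq.intervalIntegrable (μ := MeasureTheory.volume) x y)
    have h2 : 0 ≤ ∫ τ in x..y, q τ := intervalIntegral.integral_nonneg hxy (fun u _ => hq0 u)
    linarith
  · exact hp

lemma aux_h_nonneg {q : ℝ → ℝ} (hq0 : ∀ x, 0 ≤ q x) {p : ℝ}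
    {x : ℝ} (hx : 0 ≤ x) : 0 ≤ (∫ τ in (0:ℝ)..x, q τ) ^ p :=
  Real.rpow_nonneg (intervalIntegral.integral_nonneg hx (fun u _ => hq0 u)) _

lemma aux_h_le {q : ℝ → ℝ} (hq : Continuous q) (hq0 : ∀ x, 0 ≤ q x) {p B : ℝ} (hp : 0 ≤ p)
    (hB0 : 0 ≤ B) {x : ℝ} (hx : 0 ≤ x) (hx1 : x ≤ 1) (hB : ∀ t ∈ Icc (0:ℝ) 1, q t ≤ B) :
    (∫ τ in (0:ℝ)..x, q τ) ^ p ≤ B ^ p := by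
  apply Real.rpow_le_rpow
  · exact intervalIntegral.integral_nonneg hx (fun u _ => hq0 u)
  · have h1 : ∫ τ in (0:ℝ)..x, q τ ≤ ∫ τ in (0:ℝ)..x, B :=
      intervalIntegral.integral_mono_on hx (hq.intervalIntegrable _ _)
        (by simp) (fun t ht => hB t ⟨ht.1, ht.2.trans hx1⟩)
    simp at h1
    nlinarith
  · exact hp

lemma aux_int_ge {h : ℝ → ℝ} (hc : Continuous h) {x y m : ℝ} (hxy : x ≤ y)
    (hm : ∀ t ∈ Icc x y, m ≤ h t) : (y - x) * m ≤ ∫ s in x..y, h s := by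
  have h1 : ∫ τ in x..y, m ≤ ∫ τ in x..y, h τ :=
    intervalIntegral.integral_mono_on hxy (by simp) (hc.intervalIntegrable _ _) hm
  simpa using h1

lemma aux_int_le {h : ℝ → ℝ} (hc : Continuous h) {x y m : ℝ} (hxy : x ≤ y)
    (hm : ∀ t ∈ Icc x y, h t ≤ m) : ∫ s in x..y, h s ≤ (y - x) * m := by
  have h1 : ∫ τ in x..y, h τ ≤ ∫ τ in x..y, m :=
    intervalIntegral.integral_mono_on hxy (hc.intervalIntegrable _ _) (by simp) hm
  simpa using h1

/-- Delayed iterates. -/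
noncomputable def UU (w g : ℝ → ℝ) (p lam δ : ℝ) : ℕ → ℝ → ℝ → ℝ
  | 0, c, _ => c
  | k + 1, c, r => c - lam * ∫ s in (0:ℝ)..(max r 0),
      (∫ τ in (0:ℝ)..s, w τ * g (UU w g p lam δ k c (τ - δ))) ^ p

lemma UU_cont {w g : ℝ → ℝ} (hw : Continuous w) (hg : Continuous g) {p : ℝ} (hp : 0 ≤ p)
    (lam δ : ℝ) (k : ℕ) : Continuous (fun z : ℝ × ℝ => UU w g p lam δ k z.1 z.2) := by
  induction k with
  | zero => simpa [UU] using continuous_fst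
  | succ k ih =>
    simp only [UU]
    have h1 : Continuous (fun z : (ℝ × ℝ) × ℝ => w z.2 * g (UU w g p lam δ k z.1.1 (z.2 - δ))) := by
      refine (hw.comp continuous_snd).mul (hg.comp ?_)
      exact ih.comp (f := fun z : (ℝ × ℝ) × ℝ => (z.1.1, z.2 - δ)) (by fun_prop)
    have h2 : Continuous (fun z : ℝ × ℝ =>
        ∫ τ in (0:ℝ)..z.2, w τ * g (UU w g p lam δ k z.1 (τ - δ))) :=
      intervalIntegral.continuous_parametric_intervalIntegral_of_continuous
        (f := fun (z : ℝ × ℝ) τ => w τ * g (UU w g p lam δ k z.1 (τ - δ))) h1 continuous_snd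
    have h3 : Continuous (fun z : ℝ × ℝ =>
        (∫ τ in (0:ℝ)..z.2, w τ * g (UU w g p lam δ k z.1 (τ - δ))) ^ p) :=
      (Real.continuous_rpow_const hp).comp h2
    have h4 : Continuous (fun z : ℝ × ℝ => ∫ s in (0:ℝ)..(max z.2 0),
        (∫ τ in (0:ℝ)..s, w τ * g (UU w g p lam δ k z.1 (τ - δ))) ^ p) := by
      refine intervalIntegral.continuous_parametric_intervalIntegral_of_continuous
        (f := fun (z : ℝ × ℝ) s =>
          (∫ τ in (0:ℝ)..s, w τ * g (UU w g p lam δ k z.1 (τ - δ))) ^ p) ?_ (by fun_prop)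
      exact h3.comp (f := fun z : (ℝ × ℝ) × ℝ => (z.1.1, z.2)) (by fun_prop)
    exact continuous_fst.sub (continuous_const.mul h4)

lemma UU_fix {w g : ℝ → ℝ} {p : ℝ} {lam δ : ℝ} (k : ℕ) :
    ∀ c r : ℝ, r ≤ k * δ → UU w g p lam δ (k+1) c r = UU w g p lam δ k c r := by
  induction k with
  | zero =>
    intro c r hr
    have : max r 0 = 0 := max_eq_right (by simpa using hr)
    simp [UU, this]
  | succ k ih =>
    intro c r hr
    rw [UU, UU]
    congr 2
    apply intervalIntegral.integral_congr
    intro s hs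
    rcases le_total r 0 with h | h
    · rw [max_eq_right h] at hs
      simp at hs
      subst hs
      simp
    · rw [max_eq_left h, uIcc_of_le h] at hs
      simp only
      congr 1
      apply intervalIntegral.integral_congr
      intro t ht
      rw [uIcc_of_le hs.1] at ht
      simp only
      rw [ih]
      push_cast at hr
      linarith [ht.2, hs.2]

/-- The delayed shooting solution. -/
lemma exists_delay {w g : ℝ → ℝ} (hw : Continuous w) (hw0 : ∀ x, 0 ≤ w x)
    (hg : Continuous g) (hg0 : ∀ x, 0 ≤ g x) {p lam : ℝ} (hp : 0 < p) (hlam : 0 < lam)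
    {M e E c0 C : ℝ} (hM : ∀ t ∈ Icc (0:ℝ) 1, w t ≤ M) (hM0 : 0 ≤ M)
    (hc0C : c0 ≤ C) (he : ∀ x ≤ c0, g x ≤ e) (hce : lam * (M * e) ^ p ≤ c0)
    (hE : ∀ x, C / 2 ≤ x → E ≤ g x) (hE0 : 0 ≤ E)
    (hCE : C ≤ lam / 2 * ((∫ t in (0:ℝ)..(1/2), w t) * E) ^ p) (n : ℕ) :
    ∃ c ∈ Icc c0 C, ∃ v : ℝ → ℝ, Continuous v ∧ v 1 = 0 ∧ (∀ r ≤ 1, v r = c - lam *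
      ∫ s in (0:ℝ)..(max r 0), (∫ τ in (0:ℝ)..s, w τ * g (v (τ - 1/((n:ℝ)+1)))) ^ p) := by
  set δ : ℝ := 1/((n:ℝ)+1) with hδ
  have hδ0 : 0 < δ := by positivity
  set V : ℝ → ℝ → ℝ := UU w g p lam δ (n+1) with hV
  have hVc := UU_cont hw hg hp.le lam δ (n+1)
  have hVcr : ∀ c, Continuous (V c) := fun c =>
    hVc.comp (f := fun r : ℝ => (c, r)) (by fun_prop)
  have hV1 : Continuous (fun c => V c 1) :=
    hVc.comp (f := fun c : ℝ => (c, (1:ℝ))) (by fun_prop)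
  have hfix : ∀ c, ∀ r ≤ 1, V c r = c - lam *
      ∫ s in (0:ℝ)..(max r 0), (∫ τ in (0:ℝ)..s, w τ * g (V c (τ - δ))) ^ p := by
    intro c r hr
    have h1 : ((n+1 : ℕ) : ℝ) * δ = 1 := by
      rw [hδ]; push_cast; field_simp
    rw [hV, ← UU_fix (n+1) c r (by rw [h1]; exact hr), UU]
  have hq : ∀ c, Continuous (fun τ => w τ * g (V c (τ - δ))) := fun c =>
    hw.mul (hg.comp ((hVcr c).comp (by fun_prop)))
  have hq0 : ∀ c, ∀ τ, 0 ≤ w τ * g (V c (τ - δ)) := fun c τ => mul_nonneg (hw0 _) (hg0 _)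
  have hlec : ∀ c, ∀ r ≤ 1, V c r ≤ c := by
    intro c r hr
    rw [hfix c r hr]
    have : 0 ≤ ∫ s in (0:ℝ)..(max r 0), (∫ τ in (0:ℝ)..s, w τ * g (V c (τ - δ))) ^ p :=
      intervalIntegral.integral_nonneg (le_max_right _ _)
        (fun s hs => aux_h_nonneg (hq0 c) hs.1)
    nlinarith [mul_nonneg hlam.le this]
  -- small end
  have hs : 0 ≤ V c0 1 := by
    rw [hfix c0 1 le_rfl, max_eq_left zero_le_one]
    have he0 : 0 ≤ e := (hg0 _).trans (he c0 le_rfl)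
    have := aux_int_le (aux_h_cont (hq c0) hp.le) (x := 0) (y := 1) (m := (M * e) ^ p)
      zero_le_one (fun t ht => aux_h_le (hq c0) (hq0 c0) hp.le (mul_nonneg hM0 he0) ht.1 ht.2
        (fun τ hτ => mul_le_mul (hM τ hτ)
          (he _ (hlec _ _ (by linarith [hτ.2]))) (hg0 _) hM0))
    have h2 := mul_le_mul_of_nonneg_left this hlam.le
    linarith
  have hl : V C 1 ≤ 0 := by
    by_contra hcon
    push Not at hcon
    have hC1 := hfix C 1 le_rfl
    have hChalf := hfix C (1/2) (by norm_num)
    rw [max_eq_left zero_le_one] at hC1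
    rw [max_eq_left (by norm_num : (0:ℝ) ≤ 1/2)] at hChalf
    have hcont := aux_h_cont (hq C) hp.le
    set h : ℝ → ℝ := fun s => (∫ τ in (0:ℝ)..s, w τ * g (V C (τ - δ))) ^ p with hh
    have hmono : ∀ x y, 0 ≤ x → x ≤ y → h x ≤ h y := fun x y hx hxy =>
      aux_h_mono (hq C) (hq0 C) hp.le hx hxy
    have hadd := intervalIntegral.integral_add_adjacent_intervals
      (hcont.intervalIntegrable (μ := MeasureTheory.volume) 0 (1/2))
      (hcont.intervalIntegrable (μ := MeasureTheory.volume) (1/2) 1)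
    have hi1 := aux_int_le hcont (x := 0) (y := 1/2) (m := h (1/2)) (by norm_num)
      (fun t ht => hmono _ _ ht.1 ht.2)
    have hi2 := aux_int_ge hcont (x := 1/2) (y := 1) (m := h (1/2)) (by norm_num)
      (fun t ht => hmono _ _ (by linarith [ht.1]) ht.1)
    have hi0 : 0 ≤ ∫ s in (0:ℝ)..(1/2), h s := intervalIntegral.integral_nonneg (by norm_num)
      (fun s hs => aux_h_nonneg (hq0 C) hs.1)
    have hVhalf : C / 2 ≤ V C (1/2) := by
      have h1 : lam * ∫ s in (0:ℝ)..(1/2), h s ≤ lam * ∫ s in (1/2:ℝ)..1, h s :=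
        mul_le_mul_of_nonneg_left (by linarith) hlam.le
      have h2 : lam * ∫ s in (0:ℝ)..1, h s =
        (lam * ∫ s in (0:ℝ)..(1/2), h s) + lam * ∫ s in (1/2:ℝ)..1, h s := by
          rw [← hadd]; ring
      change V C 1 = C - lam * ∫ s in (0:ℝ)..1, h s at hC1
      change V C (1/2) = C - lam * ∫ s in (0:ℝ)..(1/2), h s at hChalf
      linarith
    have hVge : ∀ r ≤ 1/2, C / 2 ≤ V C r := by
      intro r hr
      refine hVhalf.trans ?_
      rw [hfix C r (by linarith), hChalf]
      have hm0 : (0:ℝ) ≤ max r 0 := le_max_right _ _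
      have hm1 : max r 0 ≤ 1/2 := max_le hr (by norm_num)
      have hadd2 := intervalIntegral.integral_add_adjacent_intervals
        (hcont.intervalIntegrable (μ := MeasureTheory.volume) 0 (max r 0))
        (hcont.intervalIntegrable (μ := MeasureTheory.volume) (max r 0) (1/2))
      have h3 : 0 ≤ ∫ s in (max r 0)..(1/2), h s := intervalIntegral.integral_nonneg hm1
        (fun s hs => aux_h_nonneg (hq0 C) (hm0.trans hs.1))
      have := mul_le_mul_of_nonneg_left (a := lam) (by linarith :
        ∫ s in (0:ℝ)..(max r 0), h s ≤ ∫ s in (0:ℝ)..(1/2), h s) hlam.le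
      change _ ≤ C - lam * ∫ s in (0:ℝ)..(max r 0), h s
      linarith
    have hhalf : ((∫ t in (0:ℝ)..(1/2), w t) * E) ^ p ≤ h (1/2) := by
      apply Real.rpow_le_rpow
      · exact mul_nonneg (intervalIntegral.integral_nonneg (by norm_num) (fun u _ => hw0 u)) hE0
      · rw [← intervalIntegral.integral_mul_const]
        refine intervalIntegral.integral_mono_on (by norm_num)
          ((hw.mul continuous_const).intervalIntegrable _ _) ((hq C).intervalIntegrable _ _) ?_
        intro t ht
        exact mul_le_mul_of_nonneg_left (hE _ (hVge _ (by linarith [ht.2]))) (hw0 t)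
      · exact hp.le
    have h5 : lam / 2 * ((∫ t in (0:ℝ)..(1/2), w t) * E) ^ p ≤ lam / 2 * h (1/2) :=
      mul_le_mul_of_nonneg_left hhalf (by positivity)
    have h6 := mul_le_mul_of_nonneg_left (a := lam) (by linarith :
        (1 - 1/2) * h (1/2) ≤ ∫ s in (0:ℝ)..1, h s) hlam.le
    change V C 1 = C - lam * ∫ s in (0:ℝ)..1, h s at hC1
    linarith
  obtain ⟨c, hc, hc1⟩ := intermediate_value_Icc' hc0C hV1.continuousOn ⟨hl, hs⟩
  exact ⟨c, hc, V c, hVcr c, hc1, hfix c⟩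

/-- Sequential Arzela-Ascoli for equi-Lipschitz functions on the unit interval. -/
lemma exists_subseq {v : ℕ → ℝ → ℝ} {A B K : ℝ} (hv : ∀ n, Continuous (v n))
    (hb : ∀ n, ∀ r ∈ Icc (0:ℝ) 1, v n r ∈ Icc A B)
    (hK : ∀ n, ∀ x ∈ Icc (0:ℝ) 1, ∀ y ∈ Icc (0:ℝ) 1, |v n x - v n y| ≤ K * |x - y|) :
    ∃ φ : ℕ → ℕ, StrictMono φ ∧ ∃ u : ℝ → ℝ, Continuous u ∧
      ∀ r ∈ Icc (0:ℝ) 1, Tendsto (fun n => v (φ n) r) atTop (nhds (u r)) := by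
  let F : ℕ → BoundedContinuousFunction (Icc (0:ℝ) 1) ℝ := fun n =>
    BoundedContinuousFunction.mkOfCompact ⟨fun x => v n x, (hv n).comp continuous_subtype_val⟩
  have hF : ∀ n x, F n x = v n x := fun n x => rfl
  have hcomp : IsCompact (closure (range F)) := by
    refine BoundedContinuousFunction.arzela_ascoli (Icc A B) isCompact_Icc (range F) ?_ ?_
    · rintro f x ⟨n, rfl⟩
      exact hb n x x.2
    · refine Metric.equicontinuous_of_continuity_modulus (fun t => K * t) ?_ _ ?_
      · have : Continuous (fun t : ℝ => K * t) := by fun_prop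
        simpa using this.tendsto 0
      · rintro x y ⟨_, n, rfl⟩
        simpa [Real.dist_eq, Subtype.dist_eq, hF] using hK n x x.2 y y.2
  obtain ⟨L, -, φ, hφ, hL⟩ := hcomp.tendsto_subseq (x := F) (fun n => subset_closure ⟨n, rfl⟩)
  refine ⟨φ, hφ, IccExtend zero_le_one L, L.continuous.Icc_extend', ?_⟩
  intro r hr
  rw [IccExtend_of_mem _ _ hr]
  have := (BoundedContinuousFunction.tendsto_iff_tendstoUniformly.1 hL).tendsto_at ⟨r, hr⟩
  simpa [hF] using this

lemma exists_sol {w g : ℝ → ℝ} (hw : Continuous w) (hw0 : ∀ x, 0 ≤ w x)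
    (hg : Continuous g) (hg0 : ∀ x, 0 ≤ g x) {p lam : ℝ} (hp : 0 < p) (hlam : 0 < lam)
    {M e E c0 C G : ℝ} (hM : ∀ t ∈ Icc (0:ℝ) 1, w t ≤ M) (hM0 : 0 ≤ M)
    (hc00 : 0 < c0)
    (hc0C : c0 ≤ C) (he : ∀ x ≤ c0, g x ≤ e) (hce : lam * (M * e) ^ p ≤ c0)
    (hE : ∀ x, C / 2 ≤ x → E ≤ g x) (hE0 : 0 ≤ E)
    (hCE : C ≤ lam / 2 * ((∫ t in (0:ℝ)..(1/2), w t) * E) ^ p)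
    (hG : ∀ x ≤ C, g x ≤ G) :
    ∃ u : ℝ → ℝ, Continuous u ∧ (∀ r ∈ Icc (0:ℝ) 1, 0 ≤ u r) ∧ (∀ r ∈ Ioo (0:ℝ) 1, 0 < u r) ∧
      ∀ r ∈ Icc (0:ℝ) 1, u r = lam * ∫ s in r..1, (∫ τ in (0:ℝ)..s, w τ * g (u τ)) ^ p := by
  choose c hc v hv hv1 hfix using
    exists_delay hw hw0 hg hg0 hp hlam hM hM0 hc0C he hce hE hE0 hCE
  have hG0 : 0 ≤ G := (hg0 _).trans (hG C le_rfl)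
  set δ : ℕ → ℝ := fun n => 1/((n:ℝ)+1) with hδ
  have hδ0 : ∀ n, 0 < δ n := fun n => by simp only [hδ]; positivity
  have hq : ∀ n, Continuous (fun τ => w τ * g (v n (τ - δ n))) := fun n =>
    hw.mul (hg.comp ((hv n).comp (by fun_prop)))
  have hq0 : ∀ n, ∀ τ, 0 ≤ w τ * g (v n (τ - δ n)) := fun n τ => mul_nonneg (hw0 _) (hg0 _)
  set h : ℕ → ℝ → ℝ := fun n s => (∫ τ in (0:ℝ)..s, w τ * g (v n (τ - δ n))) ^ p with hh
  have hhc : ∀ n, Continuous (h n) := fun n => aux_h_cont (hq n) hp.le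
  have hh0 : ∀ n, ∀ s, 0 ≤ s → 0 ≤ h n s := fun n s hs => aux_h_nonneg (hq0 n) hs
  have hfix' : ∀ n, ∀ r ≤ 1, v n r = c n - lam * ∫ s in (0:ℝ)..(max r 0), h n s := hfix
  have hdiff : ∀ n, ∀ x y, x ≤ y → y ≤ 1 →
      v n x - v n y = lam * ∫ s in (max x 0)..(max y 0), h n s := by
    intro n x y hxy hy
    rw [hfix' n x (hxy.trans hy), hfix' n y hy]
    rw [← intervalIntegral.integral_add_adjacent_intervals
        ((hhc n).intervalIntegrable (μ := MeasureTheory.volume) 0 (max x 0))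
        ((hhc n).intervalIntegrable (μ := MeasureTheory.volume) (max x 0) (max y 0))]
    ring
  have hanti : ∀ n, ∀ x y, x ≤ y → y ≤ 1 → v n y ≤ v n x := by
    intro n x y hxy hy
    have h1 := hdiff n x y hxy hy
    have h2 : 0 ≤ ∫ s in (max x 0)..(max y 0), h n s :=
      intervalIntegral.integral_nonneg (max_le_max_right 0 hxy)
        (fun s hs => hh0 n s ((le_max_right _ _).trans hs.1))
    nlinarith [mul_nonneg hlam.le h2]
  have hlec : ∀ n, ∀ r ≤ 1, v n r ≤ C := by
    intro n r hr
    refine le_trans ?_ (hc n).2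
    rw [hfix' n r hr]
    have h2 : 0 ≤ ∫ s in (0:ℝ)..(max r 0), h n s :=
      intervalIntegral.integral_nonneg (le_max_right _ _) (fun s hs => hh0 n s hs.1)
    nlinarith [mul_nonneg hlam.le h2]
  have hge0 : ∀ n, ∀ r ≤ 1, 0 ≤ v n r := fun n r hr => by
    rw [← hv1 n]; exact hanti n r 1 hr le_rfl
  have hqB : ∀ n, ∀ t ∈ Icc (0:ℝ) 1, w t * g (v n (t - δ n)) ≤ M * G := fun n t ht =>
    mul_le_mul (hM t ht) (hG _ (hlec n _ (by linarith [ht.2, hδ0 n]))) (hg0 _) hM0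
  have hhB : ∀ n, ∀ s ∈ Icc (0:ℝ) 1, h n s ≤ (M * G) ^ p := fun n s hs =>
    aux_h_le (hq n) (hq0 n) hp.le (mul_nonneg hM0 hG0) hs.1 hs.2 (hqB n)
  set K : ℝ := lam * (M * G) ^ p with hK
  have hK0 : 0 ≤ K := mul_nonneg hlam.le (Real.rpow_nonneg (mul_nonneg hM0 hG0) _)
  have hlip : ∀ n, ∀ x y, x ≤ y → y ≤ 1 → v n x - v n y ≤ K * (y - x) := by
    intro n x y hxy hy
    rw [hdiff n x y hxy hy]
    have h1 := aux_int_le (hhc n) (x := max x 0) (y := max y 0) (m := (M*G)^p)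
      (max_le_max_right 0 hxy) (fun t ht => hhB n t ⟨(le_max_right _ _).trans ht.1,
        ht.2.trans (max_le hy zero_le_one)⟩)
    have h2 : max y 0 - max x 0 ≤ y - x := by
      rcases le_total x 0 with hx | hx <;> rcases le_total y 0 with hy' | hy' <;>
        simp [hx, hy'] <;> linarith
    have h3 := mul_le_mul_of_nonneg_left h1 hlam.le
    have h4 := mul_le_mul_of_nonneg_left h2 hK0
    rw [hK] at h4 ⊢
    nlinarith
  have hlip' : ∀ n, ∀ x ∈ Icc (0:ℝ) 1, ∀ y ∈ Icc (0:ℝ) 1, |v n x - v n y| ≤ K * |x - y| := by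
    intro n x hx y hy
    rcases le_total x y with hxy | hxy
    · rw [abs_of_nonneg (by linarith [hanti n x y hxy hy.2]), abs_sub_comm,
        abs_of_nonneg (by linarith)]
      exact hlip n x y hxy hy.2
    · rw [abs_sub_comm, abs_of_nonneg (by linarith [hanti n y x hxy hx.2]),
        abs_of_nonneg (by linarith)]
      exact hlip n y x hxy hx.2
  obtain ⟨φ, hφ, u, hu, hlim⟩ := exists_subseq hv
    (fun n r hr => ⟨hge0 n r hr.2, hlec n r hr.2⟩) hlip'
  have hδlim : Tendsto (fun n => δ (φ n)) atTop (nhds 0) :=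
    (tendsto_one_div_add_atTop_nhds_zero_nat (𝕜 := ℝ)).comp hφ.tendsto_atTop
  have hlimδ : ∀ r ∈ Icc (0:ℝ) 1,
      Tendsto (fun n => v (φ n) (r - δ (φ n))) atTop (nhds (u r)) := by
    intro r hr
    have h1 : Tendsto (fun n => v (φ n) r + K * δ (φ n)) atTop (nhds (u r + K * 0)) :=
      (hlim r hr).add (hδlim.const_mul K)
    rw [mul_zero, add_zero] at h1
    refine tendsto_of_tendsto_of_tendsto_of_le_of_le (hlim r hr) h1 ?_ ?_
    · intro n
      exact hanti _ _ _ (by linarith [hδ0 (φ n)]) hr.2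
    · intro n
      have := hlip (φ n) (r - δ (φ n)) r (by linarith [hδ0 (φ n)]) hr.2
      simp only
      linarith
  have hQc : Continuous (fun τ => w τ * g (u τ)) := hw.mul (hg.comp hu)
  have hQ0 : ∀ τ, 0 ≤ w τ * g (u τ) := fun τ => mul_nonneg (hw0 _) (hg0 _)
  set H : ℝ → ℝ := fun s => (∫ τ in (0:ℝ)..s, w τ * g (u τ)) ^ p with hH
  have hHc : Continuous H := aux_h_cont hQc hp.le
  have hhlim : ∀ s ∈ Icc (0:ℝ) 1, Tendsto (fun n => h (φ n) s) atTop (nhds (H s)) := by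
    intro s hs
    refine ((Real.continuous_rpow_const hp.le).tendsto _).comp ?_
    refine intervalIntegral.tendsto_integral_filter_of_dominated_convergence
      (fun _ => M * G) ?_ ?_ (by simp) ?_
    · exact Eventually.of_forall (fun n => (hq (φ n)).aestronglyMeasurable)
    · refine Eventually.of_forall (fun n => Eventually.of_forall (fun t ht => ?_))
      rw [uIoc_of_le hs.1] at ht
      rw [Real.norm_of_nonneg (hq0 _ _)]
      exact hqB _ t ⟨ht.1.le, ht.2.trans hs.2⟩
    · refine Eventually.of_forall (fun t ht => ?_)
      rw [uIoc_of_le hs.1] at ht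
      exact ((hg.tendsto _).comp (hlimδ t ⟨ht.1.le, ht.2.trans hs.2⟩)).const_mul _
  have hIlim : ∀ r ∈ Icc (0:ℝ) 1,
      Tendsto (fun n => ∫ s in r..1, h (φ n) s) atTop (nhds (∫ s in r..1, H s)) := by
    intro r hr
    refine intervalIntegral.tendsto_integral_filter_of_dominated_convergence
      (fun _ => (M * G) ^ p) ?_ ?_ (by simp) ?_
    · exact Eventually.of_forall (fun n => (hhc (φ n)).aestronglyMeasurable)
    · refine Eventually.of_forall (fun n => Eventually.of_forall (fun t ht => ?_))
      rw [uIoc_of_le hr.2] at ht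
      have h0 : 0 ≤ t := hr.1.trans ht.1.le
      rw [Real.norm_of_nonneg (hh0 _ _ h0)]
      exact hhB _ t ⟨h0, ht.2⟩
    · refine Eventually.of_forall (fun t ht => ?_)
      rw [uIoc_of_le hr.2] at ht
      exact hhlim t ⟨hr.1.trans ht.1.le, ht.2⟩
  have hsol : ∀ r ∈ Icc (0:ℝ) 1, u r = lam * ∫ s in r..1, H s := by
    intro r hr
    refine tendsto_nhds_unique (hlim r hr) (((hIlim r hr).const_mul lam).congr ?_)
    intro n
    have := hdiff (φ n) r 1 hr.2 le_rfl
    rw [hv1, sub_zero, max_eq_left hr.1, max_eq_left zero_le_one] at this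
    exact this.symm
  have hu0 : c0 ≤ u 0 := by
    refine ge_of_tendsto (hlim 0 (by simp)) (Eventually.of_forall (fun n => ?_))
    rw [hfix' _ 0 zero_le_one]
    simpa using (hc (φ n)).1
  have hunn : ∀ r ∈ Icc (0:ℝ) 1, 0 ≤ u r := fun r hr =>
    ge_of_tendsto (hlim r hr) (Eventually.of_forall (fun n => hge0 _ r hr.2))
  refine ⟨u, hu, hunn, ?_, hsol⟩
  intro r hr
  have hr' : r ∈ Icc (0:ℝ) 1 := ⟨hr.1.le, hr.2.le⟩
  by_contra hneg
  have hz : u r = 0 := le_antisymm (not_lt.1 hneg) (hunn r hr')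
  have hmono : ∀ x y, 0 ≤ x → x ≤ y → H x ≤ H y := fun x y hx hxy =>
    aux_h_mono hQc hQ0 hp.le hx hxy
  have e1 := hsol r hr'
  have e0 := hsol 0 (by simp)
  have hadd := intervalIntegral.integral_add_adjacent_intervals
    (hHc.intervalIntegrable (μ := MeasureTheory.volume) 0 r)
    (hHc.intervalIntegrable (μ := MeasureTheory.volume) r 1)
  have hI0 : ∫ s in r..1, H s = 0 := by
    rw [hz] at e1
    rcases mul_eq_zero.1 e1.symm with h | h
    · exact absurd h hlam.ne'
    · exact h
  have h1 := aux_int_ge hHc (x := r) (y := 1) (m := H r) hr.2.le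
    (fun t ht => hmono _ _ hr.1.le ht.1)
  have h2 := aux_int_le hHc (x := 0) (y := r) (m := H r) hr.1.le
    (fun t ht => hmono _ _ ht.1 ht.2)
  have hHr : H r ≤ 0 := by
    by_contra hcon
    push Not at hcon
    nlinarith [mul_pos (sub_pos.2 hr.2) hcon]
  have h3 : ∫ s in (0:ℝ)..1, H s ≤ 0 := by nlinarith [hr.1]
  nlinarith

end Helpers

theorem stmt17 (N : ℕ) (hN : 1 ≤ N) (a : ℝ → ℝ)
    (ha : ContinuousOn a (Icc 0 1)) (ha0 : ∀ r ∈ Icc (0:ℝ) 1, 0 ≤ a r)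
    (hanv : ∀ s t : ℝ, 0 ≤ s → s < t → t ≤ 1 → ∃ r ∈ Ioo s t, a r ≠ 0)
    (f : ℝ → ℝ) (hf : ContinuousOn f (Ici 0))
    (hfnonneg : ∀ s ≥ (0:ℝ), 0 ≤ f s) (hfpos : ∀ s > (0:ℝ), 0 < f s)
    (h0 : Tendsto (fun s => f s / s ^ N) (nhdsWithin 0 (Ioi 0)) (nhds 0))
    (hinf : Tendsto (fun s => f s / s ^ N) atTop atTop)
    (lam : ℝ) (hlam : 0 < lam) :
    ∃ v : ℝ → ℝ, ContinuousOn v (Icc 0 1) ∧ (∀ r ∈ Icc (0:ℝ) 1, 0 ≤ v r) ∧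
      (∀ r ∈ Ioo (0:ℝ) 1, 0 < v r) ∧
      ∀ r ∈ Icc (0:ℝ) 1, v r = lam * TF N a f v r := by
  have hN0 : N ≠ 0 := by omega
  have hNpos : (0:ℝ) < N := by exact_mod_cast hN
  set A : ℝ → ℝ := IccExtend (zero_le_one (α := ℝ)) (fun x : Icc (0:ℝ) 1 => a x) with hA
  have hAc : Continuous A :=
    (continuousOn_iff_continuous_domRestrict.1 ha).Icc_extend'
  have hAeq : ∀ r ∈ Icc (0:ℝ) 1, A r = a r := fun r hr => by
    rw [hA, IccExtend_of_mem _ _ hr]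
  have hA0 : ∀ x, 0 ≤ A x := fun x => ha0 _ (projIcc (0:ℝ) 1 zero_le_one x).2
  set w : ℝ → ℝ := fun t => (N:ℝ) * |t| ^ (N-1) * A t with hwdef
  have hw : Continuous w := by fun_prop
  have hw0 : ∀ x, 0 ≤ w x := fun x => by
    have := hA0 x
    simp only [hwdef]; positivity
  have hweq : ∀ r ∈ Icc (0:ℝ) 1, w r = (N:ℝ) * r ^ (N-1) * a r := fun r hr => by
    simp only [hwdef]; rw [hAeq r hr, abs_of_nonneg hr.1]
  set g : ℝ → ℝ := fun x => f (max x 0) with hgdef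
  have hg : Continuous g :=
    hf.comp_continuous (by fun_prop) (fun x => mem_Ici.2 (le_max_right _ _))
  have hg0 : ∀ x, 0 ≤ g x := fun x => hfnonneg _ (le_max_right _ _)
  have hgeq : ∀ x, 0 ≤ x → g x = f x := fun x hx => by simp only [hgdef]; rw [max_eq_left hx]
  obtain ⟨M, hM1, hM⟩ : ∃ M : ℝ, 1 ≤ M ∧ ∀ t ∈ Icc (0:ℝ) 1, w t ≤ M := by
    obtain ⟨B, hB⟩ := (isCompact_Icc (a := (0:ℝ)) (b := 1)).bddAbove_image hw.continuousOn
    exact ⟨max B 1, le_max_right _ _,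
      fun t ht => (hB (mem_image_of_mem w ht)).trans (le_max_left _ _)⟩
  have hMpos : 0 < M := by linarith
  set W : ℝ := ∫ t in (0:ℝ)..(1/2), w t with hW
  have hWpos : 0 < W := by
    obtain ⟨r, hr, hr0⟩ := hanv 0 (1/2) le_rfl (by norm_num) (by norm_num)
    refine intervalIntegral.integral_pos (by norm_num) hw.continuousOn (fun x _ => hw0 x)
      ⟨r, ⟨hr.1.le, hr.2.le⟩, ?_⟩
    have hr1 : r ∈ Icc (0:ℝ) 1 := ⟨hr.1.le, by linarith [hr.2]⟩
    rw [hweq r hr1]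
    have := hr.1
    have h2 : 0 < a r := lt_of_le_of_ne (ha0 r hr1) hr0.symm
    positivity
  have hroot : ∀ x : ℝ, 0 ≤ x → (x ^ N) ^ ((1:ℝ) / N) = x := fun x hx => by
    rw [one_div]; exact Real.pow_rpow_inv_natCast hx hN0
  -- small end
  obtain ⟨c0, hc0, hsmall⟩ : ∃ c0 : ℝ, 0 < c0 ∧ ∀ s, 0 < s → s ≤ c0 →
      f s ≤ (1 / (M * lam ^ N)) * s ^ N := by
    have hε : (0:ℝ) < 1 / (M * lam ^ N) := by positivity
    have h1 := h0.eventually (gt_mem_nhds hε)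
    obtain ⟨b, hb, hb'⟩ := (mem_nhdsGT_iff_exists_Ioc_subset).1 h1
    refine ⟨b, hb, fun s hs hsb => ?_⟩
    have h2 : f s / s ^ N < 1 / (M * lam ^ N) := hb' ⟨hs, hsb⟩
    exact ((div_lt_iff₀ (by positivity)).1 h2).le
  set e : ℝ := (1 / (M * lam ^ N)) * c0 ^ N with hedef
  have hse : ∀ s, 0 < s → s ≤ c0 → f s ≤ e := fun s hs hsc => by
    refine (hsmall s hs hsc).trans ?_
    rw [hedef]
    gcongr
  have hf0 : f 0 ≤ e := by
    have ht : Tendsto f (nhdsWithin 0 (Ioi 0)) (nhds (f 0)) :=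
      (hf 0 self_mem_Ici).mono_left (nhdsWithin_mono _ Ioi_subset_Ici_self)
    refine le_of_tendsto ht ?_
    filter_upwards [Ioc_mem_nhdsGT hc0] with s hs
    exact hse s hs.1 hs.2
  have he : ∀ x ≤ c0, g x ≤ e := fun x hx => by
    rcases le_or_gt x 0 with h | h
    · simp only [hgdef]; rw [max_eq_right h]; exact hf0
    · rw [hgeq x h.le]; exact hse x h hx
  have hce : lam * (M * e) ^ ((1:ℝ) / N) ≤ c0 := by
    have : M * e = (c0 / lam) ^ N := by rw [hedef, div_pow]; field_simp
    rw [this, hroot _ (by positivity)]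
    apply le_of_eq; field_simp
  -- large end
  set m : ℝ := (4 / lam) ^ N / W with hm
  have hmpos : 0 < m := by positivity
  obtain ⟨S, hS⟩ := eventually_atTop.1 (hinf.eventually (eventually_ge_atTop m))
  set C : ℝ := 2 * max S c0 with hC
  have hCc : c0 ≤ C := by
    have := le_max_right S c0
    linarith
  have hC0 : 0 < C := by linarith
  have hSC : S ≤ C / 2 := by
    have := le_max_left S c0
    linarith
  have hE : ∀ x, C / 2 ≤ x → m * (C / 2) ^ N ≤ g x := fun x hx => by
    have hx0 : 0 < x := by linarith
    rw [hgeq x hx0.le]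
    have h1 := (le_div_iff₀ (by positivity)).1 (hS x (hSC.trans hx))
    refine le_trans ?_ h1
    gcongr
  have hCE : C ≤ lam / 2 * (W * (m * (C / 2) ^ N)) ^ ((1:ℝ) / N) := by
    have : W * (m * (C / 2) ^ N) = (2 * C / lam) ^ N := by
      have h1 : (2 * C / lam) = (4 / lam) * (C / 2) := by ring
      rw [h1, mul_pow, hm]
      field_simp
    rw [this, hroot _ (by positivity)]
    apply le_of_eq; field_simp
  obtain ⟨G, hG⟩ : ∃ G : ℝ, ∀ x ≤ C, g x ≤ G := by
    obtain ⟨B, hB⟩ := (isCompact_Icc (a := (0:ℝ)) (b := C)).bddAbove_image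
      (hf.mono Icc_subset_Ici_self)
    exact ⟨B, fun x hx => hB (mem_image_of_mem f ⟨le_max_right _ _, max_le hx hC0.le⟩)⟩
  obtain ⟨u, hu, hu0, hupos, hsol⟩ := exists_sol hw hw0 hg hg0
    (by positivity : (0:ℝ) < 1 / N) hlam hM hMpos.le hc0 hCc he hce hE (by positivity) hCE hG
  refine ⟨u, hu.continuousOn, hu0, hupos, fun r hr => ?_⟩
  rw [hsol r hr, TF]
  congr 1
  apply intervalIntegral.integral_congr
  intro s hs
  rw [uIcc_of_le hr.2] at hs
  simp only
  congr 1
  apply intervalIntegral.integral_congr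
  intro t ht
  rw [uIcc_of_le (hr.1.trans hs.1)] at ht
  have ht1 : t ∈ Icc (0:ℝ) 1 := ⟨ht.1, ht.2.trans hs.2⟩
  simp only
  rw [hweq t ht1, hgeq _ (hu0 t ht1)]
end

section
/- Let f : [0,∞) → [0,∞) be continuous with f(s) > 0 for all s > 0, and assume f₀ = +∞ and f∞ = +∞ (i.e., f(s)/s^N → +∞ both as s → 0⁺ and as s → +∞). Then there exists λ* > 0 such that for every λ ∈ (0, λ*) there exist two distinct functions v₁, v₂ ∈ C([0,1],[0,∞)), each satisfying v_i = λ T_f v_i and v_i(r) > 0 for all r ∈ (0,1); equivalently, the radial Monge–Ampère problem has at least two negative, strictly convex solutions. -/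
open Set Filter Topology intervalIntegral

noncomputable def HH (g F : ℝ → ℝ) (p ε : ℝ) (w : ℝ → ℝ) (s : ℝ) : ℝ :=
  (∫ τ in (0:ℝ)..s, g τ * F (w (τ - ε))) ^ p

def IsSol (g F : ℝ → ℝ) (p lam ε d : ℝ) (w : ℝ → ℝ) : Prop :=
  Continuous w ∧ ∀ r ≤ (1:ℝ), w r = d - lam * ∫ s in (0:ℝ)..(max r 0), HH g F p ε w s

section
variable {g F : ℝ → ℝ} {p lam ε d : ℝ} {w : ℝ → ℝ}

theorem HH_cont (hg : Continuous g) (hF : Continuous F) (hp : 0 ≤ p) (hw : Continuous w) :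
    Continuous (HH g F p ε w) := by
  unfold HH
  have h : Continuous fun s : ℝ => ∫ τ in (0:ℝ)..s, g τ * F (w (τ - ε)) :=
    intervalIntegral.continuous_primitive
      (fun a b => (Continuous.intervalIntegrable (by fun_prop) a b)) 0
  exact h.rpow_const (fun _ => Or.inr hp)

theorem HH_nonneg (hg0 : ∀ x, 0 ≤ g x) (hF0 : ∀ x, 0 ≤ F x) {s : ℝ} (hs : 0 ≤ s) :
    0 ≤ HH g F p ε w s :=
  Real.rpow_nonneg (intervalIntegral.integral_nonneg hs
    (fun _ _ => mul_nonneg (hg0 _) (hF0 _))) _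

theorem HH_mono (hg : Continuous g) (hF : Continuous F) (hp : 0 ≤ p) (hw : Continuous w)
    (hg0 : ∀ x, 0 ≤ g x) (hF0 : ∀ x, 0 ≤ F x) {s t : ℝ} (hs : 0 ≤ s) (hst : s ≤ t) :
    HH g F p ε w s ≤ HH g F p ε w t := by
  unfold HH
  apply Real.rpow_le_rpow _ _ hp
  · exact intervalIntegral.integral_nonneg hs (fun _ _ => mul_nonneg (hg0 _) (hF0 _))
  · apply intervalIntegral.integral_mono_interval le_rfl hs hst
    · exact Filter.Eventually.of_forall (fun x => mul_nonneg (hg0 _) (hF0 _))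
    · exact Continuous.intervalIntegrable (by fun_prop) _ _

theorem IsSol.diff (hg : Continuous g) (hF : Continuous F) (hp : 0 ≤ p)
    (h : IsSol g F p lam ε d w) {r s : ℝ} (hrs : r ≤ s) (hs : s ≤ 1) :
    w r - w s = lam * ∫ x in (max r 0)..(max s 0), HH g F p ε w x := by
  have hc := HH_cont (ε := ε) hg hF hp h.1
  rw [h.2 r (hrs.trans hs), h.2 s hs, ← intervalIntegral.integral_interval_sub_left
    (hc.intervalIntegrable 0 (max s 0)) (hc.intervalIntegrable 0 (max r 0))]
  ring

theorem IsSol.anti (hg : Continuous g) (hF : Continuous F) (hp : 0 ≤ p)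
    (hg0 : ∀ x, 0 ≤ g x) (hF0 : ∀ x, 0 ≤ F x) (hlam : 0 < lam)
    (h : IsSol g F p lam ε d w) {r s : ℝ} (hrs : r ≤ s) (hs : s ≤ 1) :
    w s ≤ w r := by
  have h1 := h.diff hg hF hp hrs hs
  have : 0 ≤ ∫ x in (max r 0)..(max s 0), HH g F p ε w x :=
    intervalIntegral.integral_nonneg (max_le_max hrs le_rfl)
      (fun x hx => HH_nonneg hg0 hF0 ((le_max_right _ _).trans hx.1))
  nlinarith [mul_nonneg hlam.le this]

theorem IsSol.zero (h : IsSol g F p lam ε d w) {r : ℝ} (hr : r ≤ 0) : w r = d := by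
  rw [h.2 r (hr.trans zero_le_one), max_eq_right hr]; simp

theorem IsSol.le (hg : Continuous g) (hF : Continuous F) (hp : 0 ≤ p)
    (hg0 : ∀ x, 0 ≤ g x) (hF0 : ∀ x, 0 ≤ F x) (hlam : 0 < lam)
    (h : IsSol g F p lam ε d w) {r : ℝ} (hr : r ≤ 1) : w r ≤ d := by
  rcases le_total r 0 with h0 | h0
  · exact (h.zero h0).le
  · have := h.anti hg hF hp hg0 hF0 hlam h0 hr
    rwa [h.zero le_rfl] at this

theorem HH_le (hg : Continuous g) (hF : Continuous F) (hp : 0 ≤ p) (hw : Continuous w)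
    (hg0 : ∀ x, 0 ≤ g x) (hF0 : ∀ x, 0 ≤ F x) {M : ℝ}
    (hM : ∀ x ≤ 1, F (w (x - ε)) ≤ M) {s : ℝ} (hs : 0 ≤ s) (hs1 : s ≤ 1) :
    HH g F p ε w s ≤ ((∫ x in (0:ℝ)..1, g x) * M) ^ p := by
  refine (HH_mono hg hF hp hw hg0 hF0 hs hs1).trans ?_
  unfold HH
  apply Real.rpow_le_rpow _ _ hp
  · exact intervalIntegral.integral_nonneg zero_le_one (fun _ _ => mul_nonneg (hg0 _) (hF0 _))
  · rw [← intervalIntegral.integral_mul_const]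
    apply intervalIntegral.integral_mono_on zero_le_one
    · exact Continuous.intervalIntegrable (by fun_prop) _ _
    · exact Continuous.intervalIntegrable (by fun_prop) _ _
    · intro x hx
      exact mul_le_mul_of_nonneg_left (hM x hx.2) (hg0 x)

theorem IsSol.lip (hg : Continuous g) (hF : Continuous F) (hp : 0 ≤ p)
    (hg0 : ∀ x, 0 ≤ g x) (hF0 : ∀ x, 0 ≤ F x) (hlam : 0 < lam) (hε : 0 ≤ ε)
    (h : IsSol g F p lam ε d w) {M D : ℝ} (hd : d ≤ D) (hM : ∀ x ≤ D, F x ≤ M)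
    {r s : ℝ} (hrs : r ≤ s) (hs : s ≤ 1) :
    w r - w s ≤ lam * ((∫ x in (0:ℝ)..1, g x) * M) ^ p * (s - r) := by
  have hc := HH_cont (ε := ε) hg hF hp h.1
  have hM0 : 0 ≤ M := (hF0 D).trans (hM D le_rfl)
  have hgi : 0 ≤ ∫ x in (0:ℝ)..1, g x :=
    intervalIntegral.integral_nonneg zero_le_one (fun _ _ => hg0 _)
  have hL : 0 ≤ ((∫ x in (0:ℝ)..1, g x) * M) ^ p := by positivity
  rw [h.diff hg hF hp hrs hs, mul_assoc]
  apply mul_le_mul_of_nonneg_left _ hlam.le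
  have hmm : max r 0 ≤ max s 0 := max_le_max hrs le_rfl
  have : ∫ x in (max r 0)..(max s 0), HH g F p ε w x ≤
      ∫ x in (max r 0)..(max s 0), ((∫ x in (0:ℝ)..1, g x) * M) ^ p := by
    apply intervalIntegral.integral_mono_on hmm (hc.intervalIntegrable _ _) (by simp)
    intro x hx
    apply HH_le hg hF hp h.1 hg0 hF0 _ ((le_max_right _ _).trans hx.1)
      (hx.2.trans (max_le hs zero_le_one))
    intro y hy
    exact hM _ ((h.le hg hF hp hg0 hF0 hlam (by linarith)).trans hd)
  refine this.trans ?_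
  rw [intervalIntegral.integral_const, smul_eq_mul, mul_comm]
  apply mul_le_mul_of_nonneg_left _ hL
  rcases le_total r 0 with h1 | h1 <;> rcases le_total s 0 with h2 | h2 <;>
    simp [h1, h2] <;> linarith

theorem IsSol.neg {N : ℕ} (hN : 1 ≤ N) (hg : Continuous g) (hF : Continuous F)
    (hg0 : ∀ x, 0 ≤ g x) (hF0 : ∀ x, 0 ≤ F x) (hlam : 0 < lam) (hε : 0 ≤ ε) (hd : 0 < d)
    (h : IsSol g F ((1:ℝ) / N) lam ε d w)
    (hlow : ∀ s ∈ Icc (d / 2) d, (2 * d / lam) ^ N ≤ (∫ x in (0:ℝ)..(1/2), g x) * F s) :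
    w 1 ≤ 0 := by
  by_contra! hw
  have hp : (0:ℝ) ≤ (1:ℝ) / N := by positivity
  have hc := HH_cont (ε := ε) hg hF hp h.1
  have h1 := h.diff hg hF hp (r := 0) (s := 1/2) (by norm_num) (by norm_num)
  have h2 := h.diff hg hF hp (r := 1/2) (s := 1) (by norm_num) (by norm_num)
  have e : max (1/2:ℝ) 0 = 1/2 := by norm_num
  have e1 : max (1:ℝ) 0 = 1 := by norm_num
  rw [e, max_self] at h1
  rw [e, e1] at h2
  set H := HH g F ((1:ℝ) / N) ε w with hH
  have i1 : ∫ x in (0:ℝ)..(1/2), H x ≤ ∫ x in (0:ℝ)..(1/2), H (1/2) := by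
    apply intervalIntegral.integral_mono_on (by norm_num) (hc.intervalIntegrable _ _) (by simp)
    intro x hx
    exact HH_mono hg hF hp h.1 hg0 hF0 hx.1 hx.2
  have i2 : ∫ x in (1/2:ℝ)..1, H (1/2) ≤ ∫ x in (1/2:ℝ)..1, H x := by
    apply intervalIntegral.integral_mono_on (by norm_num) (by simp) (hc.intervalIntegrable _ _)
    intro x hx
    exact HH_mono hg hF hp h.1 hg0 hF0 (by norm_num) hx.1
  rw [intervalIntegral.integral_const, smul_eq_mul] at i1 i2
  have hz := h.zero le_rfl
  have j1 := mul_le_mul_of_nonneg_left i1 hlam.le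
  have j2 := mul_le_mul_of_nonneg_left i2 hlam.le
  have hhalf : d / 2 ≤ w (1/2) := by linarith
  have hb : 2 * d / lam ≤ H (1/2) := by
    have hx : 2 * d / lam = ((2 * d / lam) ^ N) ^ ((1:ℝ) / N) := by
      rw [one_div, Real.pow_rpow_inv_natCast (by positivity) (by omega)]
    rw [hx, hH, HH]
    apply Real.rpow_le_rpow (by positivity) _ hp
    have hc2 : 0 < ∫ x in (0:ℝ)..(1/2), g x := by
      have := hlow d ⟨by linarith, le_rfl⟩
      have h3 : 0 < (2 * d / lam) ^ N := by positivity
      have h4 : 0 ≤ ∫ x in (0:ℝ)..(1/2), g x :=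
        intervalIntegral.integral_nonneg (by norm_num) (fun _ _ => hg0 _)
      rcases h4.eq_or_lt with h5 | h5
      · rw [← h5] at this; linarith
      · exact h5
    have : (2 * d / lam) ^ N = ∫ x in (0:ℝ)..(1/2), g x *
        ((2 * d / lam) ^ N / ∫ x in (0:ℝ)..(1/2), g x) := by
      rw [intervalIntegral.integral_mul_const]
      field_simp
    rw [this]
    apply intervalIntegral.integral_mono_on (by norm_num)
      (Continuous.intervalIntegrable (by fun_prop) _ _)
      (Continuous.intervalIntegrable (by have := h.1; fun_prop) _ _)
    intro x hx
    apply mul_le_mul_of_nonneg_left _ (hg0 x)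
    rw [div_le_iff₀ hc2, mul_comm (F _)]
    apply hlow
    constructor
    · exact hhalf.trans (h.anti hg hF hp hg0 hF0 hlam (by linarith [hx.2]) (by norm_num))
    · exact h.le hg hF hp hg0 hF0 hlam (by linarith [hx.2])
  rw [div_le_iff₀ hlam] at hb
  have h0' := h.anti hg hF hp hg0 hF0 hlam (r := 0) (s := 1/2) (by norm_num) (by norm_num)
  linarith

end

/-- Tonelli approximation. -/
noncomputable def VV (g F : ℝ → ℝ) (p lam ε : ℝ) : ℕ → ℝ → ℝ → ℝ
  | 0 => fun d _ => d
  | k + 1 => fun d r => d - lam * ∫ s in (0:ℝ)..(max r 0), HH g F p ε (VV g F p lam ε k d) s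

section
variable {g F : ℝ → ℝ} {p lam ε d : ℝ} {w : ℝ → ℝ}

theorem VV_cont (hg : Continuous g) (hF : Continuous F) (hp : 0 ≤ p) (k : ℕ) :
    Continuous (Function.uncurry (VV g F p lam ε k)) := by
  induction k with
  | zero => exact continuous_fst
  | succ k ih =>
    have h1 : Continuous (fun x : ℝ × ℝ => HH g F p ε (VV g F p lam ε k x.1) x.2) := by
      unfold HH
      refine Continuous.rpow_const ?_ (fun _ => Or.inr hp)
      apply intervalIntegral.continuous_parametric_intervalIntegral_of_continuous
        (f := fun (x : ℝ × ℝ) τ => g τ * F (VV g F p lam ε k x.1 (τ - ε))) _ continuous_snd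
      have : Continuous fun y : (ℝ × ℝ) × ℝ => VV g F p lam ε k y.1.1 (y.2 - ε) :=
        ih.comp (by fun_prop : Continuous fun y : (ℝ × ℝ) × ℝ => (y.1.1, y.2 - ε))
      simp only [Function.uncurry_def]
      fun_prop
    have h2 : Continuous fun x : ℝ × ℝ =>
        ∫ s in (0:ℝ)..(max x.2 0), HH g F p ε (VV g F p lam ε k x.1) s := by
      apply intervalIntegral.continuous_parametric_intervalIntegral_of_continuous
        (f := fun (x : ℝ × ℝ) s => HH g F p ε (VV g F p lam ε k x.1) s) _ (by fun_prop)
      exact h1.comp (by fun_prop : Continuous fun y : (ℝ × ℝ) × ℝ => (y.1.1, y.2))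
    simp only [VV, Function.uncurry_def]
    fun_prop

theorem VV_stab (hε : 0 < ε) (k : ℕ) : ∀ r ≤ k * ε,
    VV g F p lam ε (k + 1) d r = VV g F p lam ε k d r := by
  induction k with
  | zero =>
    intro r hr
    have : r ≤ 0 := by simpa using hr
    simp [VV, max_eq_right this]
  | succ k ih =>
    intro r hr
    change d - lam * ∫ s in (0:ℝ)..(max r 0), HH g F p ε (VV g F p lam ε (k + 1) d) s =
      d - lam * ∫ s in (0:ℝ)..(max r 0), HH g F p ε (VV g F p lam ε k d) s
    congr 2
    apply intervalIntegral.integral_congr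
    intro s hs
    rw [uIcc_of_le (le_max_right _ _)] at hs
    simp only [HH]
    congr 1
    apply intervalIntegral.integral_congr
    intro τ hτ
    rw [uIcc_of_le hs.1] at hτ
    simp only
    rw [ih]
    have : max r 0 ≤ ((k + 1 : ℕ) : ℝ) * ε := max_le hr (by positivity)
    push_cast at this
    linarith [hτ.2, hs.2]

theorem VV_sol (hg : Continuous g) (hF : Continuous F) (hp : 0 ≤ p) (n : ℕ) (d : ℝ) :
    IsSol g F p lam (1 / ((n:ℝ) + 1)) d (VV g F p lam (1 / ((n:ℝ) + 1)) (n + 1) d) := by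
  refine ⟨(VV_cont hg hF hp (n + 1)).comp (by fun_prop : Continuous fun r : ℝ => (d, r)), ?_⟩
  intro r hr
  rw [← VV_stab (by positivity) (n + 1) r, VV]
  push_cast
  field_simp
  exact hr
end

section
variable {g F : ℝ → ℝ} {p lam : ℝ}

theorem limit_sol_s18 (hg : Continuous g) (hF : Continuous F) (hp : 0 ≤ p)
    (hg0 : ∀ x, 0 ≤ g x) (hF0 : ∀ x, 0 ≤ F x) (hlam : 0 < lam) {M d1 d2 : ℝ}
    (hM : ∀ x ≤ d2, F x ≤ M) (d : ℕ → ℝ) (w : ℕ → ℝ → ℝ)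
    (hd : ∀ n, d n ∈ Icc d1 d2)
    (hw : ∀ n : ℕ, IsSol g F p lam (1 / ((n:ℝ) + 1)) (d n) (w n)) (hw1 : ∀ n, w n 1 = 0) :
    ∃ v e, e ∈ Icc d1 d2 ∧ IsSol g F p lam 0 e v ∧ v 1 = 0 := by
  have hε : ∀ n : ℕ, (0:ℝ) ≤ 1 / ((n:ℝ) + 1) := fun n => by positivity
  set L := lam * ((∫ x in (0:ℝ)..1, g x) * M) ^ p with hLdef
  have hM0 : 0 ≤ M := (hF0 d2).trans (hM d2 le_rfl)
  have hgi : 0 ≤ ∫ x in (0:ℝ)..1, g x :=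
    intervalIntegral.integral_nonneg zero_le_one (fun _ _ => hg0 _)
  have hL : 0 ≤ L := by positivity
  have hlip : ∀ n, ∀ r ≤ (1:ℝ), ∀ s ≤ (1:ℝ), |w n r - w n s| ≤ L * |r - s| := by
    intro n
    have key : ∀ r s : ℝ, r ≤ s → s ≤ 1 → |w n r - w n s| ≤ L * |r - s| := by
      intro r s hrs hs
      have h1 := (hw n).lip hg hF hp hg0 hF0 hlam (hε n) (hd n).2 hM hrs hs
      have h2 := (hw n).anti hg hF hp hg0 hF0 hlam hrs hs
      rw [abs_of_nonneg (by linarith), abs_sub_comm, abs_of_nonneg (by linarith)]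
      exact h1
    intro r hr s hs
    rcases le_total r s with h | h
    · exact key r s h hs
    · rw [abs_sub_comm, abs_sub_comm r]; exact key s r h hr
  let u : ℕ → BoundedContinuousFunction (Icc (0:ℝ) 1) ℝ := fun n =>
    BoundedContinuousFunction.mkOfCompact ⟨fun x => w n x, (hw n).1.comp continuous_subtype_val⟩
  have hu : ∀ n (x : Icc (0:ℝ) 1), u n x = w n x := fun n x => rfl
  have hcomp : IsCompact (closure (range u)) := by
    apply BoundedContinuousFunction.arzela_ascoli (Icc 0 d2) isCompact_Icc
    · rintro _ x ⟨n, rfl⟩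
      rw [hu]
      constructor
      · refine (hw1 n).symm.le.trans ?_
        exact (hw n).anti hg hF hp hg0 hF0 hlam x.2.2 le_rfl
      · exact ((hw n).le hg hF hp hg0 hF0 hlam x.2.2).trans (hd n).2
    · apply UniformEquicontinuous.equicontinuous
      apply LipschitzWith.uniformEquicontinuous _ (Real.toNNReal L)
      rintro ⟨_, n, rfl⟩
      apply LipschitzWith.of_dist_le_mul
      intro x y
      rw [Real.coe_toNNReal _ hL, Real.dist_eq]
      exact hlip n x x.2.2 y y.2.2
  obtain ⟨U, -, φ, hφ, hlim⟩ := hcomp.tendsto_subseq (x := u)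
    (fun n => subset_closure (mem_range_self n))
  have hptw : ∀ x : Icc (0:ℝ) 1, Tendsto (fun n => w (φ n) x) atTop (𝓝 (U x)) := by
    intro x
    exact ((continuous_eval_const x :
      Continuous fun G : BoundedContinuousFunction (Icc (0:ℝ) 1) ℝ => G x).tendsto U).comp hlim
  let v : ℝ → ℝ := fun r => U (projIcc 0 1 zero_le_one r)
  have hvc : Continuous v := U.continuous.comp continuous_projIcc
  have hv : ∀ r ≤ (1:ℝ), Tendsto (fun n => w (φ n) r) atTop (𝓝 (v r)) := by
    intro r hr
    have := hptw (projIcc 0 1 zero_le_one r)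
    refine this.congr ?_
    intro n
    rcases le_total r 0 with h | h
    · rw [projIcc_of_le_left _ h, (hw _).zero h, (hw _).zero le_rfl]
    · rw [projIcc_of_mem zero_le_one ⟨h, hr⟩]
  have heps : Tendsto (fun n => 1 / ((φ n : ℝ) + 1)) atTop (𝓝 0) :=
    tendsto_one_div_add_atTop_nhds_zero_nat.comp hφ.tendsto_atTop
  have hvd : ∀ r ≤ (1:ℝ), Tendsto (fun n => w (φ n) (r - 1 / ((φ n : ℝ) + 1))) atTop (𝓝 (v r)) := by
    intro r hr
    have h1 : Tendsto (fun n => w (φ n) (r - 1 / ((φ n : ℝ) + 1)) - w (φ n) r) atTop (𝓝 0) := by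
      apply squeeze_zero_norm (a := fun n => L * (1 / ((φ n : ℝ) + 1)))
      · intro n
        have := hlip (φ n) (r - 1 / ((φ n : ℝ) + 1)) (by linarith [hε (φ n)]) r hr
        rw [Real.norm_eq_abs]
        refine this.trans (le_of_eq ?_)
        rw [sub_sub_cancel_left, abs_neg, abs_of_nonneg (hε _)]
      · simpa using heps.const_mul L
    simpa using h1.add (hv r hr)
  have hMb : ∀ n, ∀ x ≤ (1:ℝ), F (w (φ n) (x - 1 / ((φ n : ℝ) + 1))) ≤ M := by
    intro n x hx
    exact hM _ (((hw _).le hg hF hp hg0 hF0 hlam (by linarith [hε (φ n)])).trans (hd _).2)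
  have hH : ∀ s ∈ Icc (0:ℝ) 1, Tendsto (fun n => HH g F p (1 / ((φ n : ℝ) + 1)) (w (φ n)) s) atTop
      (𝓝 (HH g F p 0 v s)) := by
    intro s hs
    unfold HH
    refine Tendsto.rpow_const ?_ (Or.inr hp)
    apply intervalIntegral.tendsto_integral_filter_of_dominated_convergence (fun x => g x * M)
    · refine Eventually.of_forall fun n => Continuous.aestronglyMeasurable ?_
      have := (hw (φ n)).1
      fun_prop
    · refine Eventually.of_forall fun n => Eventually.of_forall fun x hx => ?_
      rw [uIoc_of_le hs.1] at hx
      rw [Real.norm_eq_abs, abs_of_nonneg (mul_nonneg (hg0 _) (hF0 _))]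
      exact mul_le_mul_of_nonneg_left (hMb n x (hx.2.trans hs.2)) (hg0 _)
    · exact Continuous.intervalIntegrable (by fun_prop) _ _
    · refine Eventually.of_forall fun x hx => ?_
      rw [uIoc_of_le hs.1] at hx
      apply Tendsto.const_mul
      rw [sub_zero]
      exact (hF.tendsto _).comp (hvd x (hx.2.trans hs.2))
  have hv0 : Tendsto (fun n => d (φ n)) atTop (𝓝 (v 0)) := by
    refine (hv 0 zero_le_one).congr fun n => (hw _).zero le_rfl
  refine ⟨v, v 0, isClosed_Icc.mem_of_tendsto hv0 (Eventually.of_forall fun n => hd _),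
    ⟨hvc, ?_⟩, ?_⟩
  · intro r hr
    refine tendsto_nhds_unique (hv r hr) ?_
    have : Tendsto (fun n => d (φ n) - lam * ∫ s in (0:ℝ)..(max r 0),
        HH g F p (1 / ((φ n : ℝ) + 1)) (w (φ n)) s) atTop
        (𝓝 (v 0 - lam * ∫ s in (0:ℝ)..(max r 0), HH g F p 0 v s)) := by
      refine hv0.sub (Tendsto.const_mul _ ?_)
      have hm1 : max r 0 ≤ 1 := max_le hr zero_le_one
      apply intervalIntegral.tendsto_integral_filter_of_dominated_convergence
        (fun _ => ((∫ x in (0:ℝ)..1, g x) * M) ^ p)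
      · exact Eventually.of_forall fun n =>
          (HH_cont hg hF hp (hw (φ n)).1).aestronglyMeasurable
      · refine Eventually.of_forall fun n => Eventually.of_forall fun x hx => ?_
        rw [uIoc_of_le (le_max_right _ _)] at hx
        rw [Real.norm_eq_abs, abs_of_nonneg (HH_nonneg hg0 hF0 hx.1.le)]
        exact HH_le hg hF hp (hw _).1 hg0 hF0 (hMb n) hx.1.le (hx.2.trans hm1)
      · simp
      · refine Eventually.of_forall fun x hx => ?_
        rw [uIoc_of_le (le_max_right _ _)] at hx
        exact hH x ⟨hx.1.le, hx.2.trans hm1⟩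
    exact this.congr fun n => ((hw (φ n)).2 r hr).symm
  · refine tendsto_nhds_unique (hv 1 le_rfl) ?_
    simp [hw1]

/-- Shooting: a sign change of the terminal value yields a solution. -/
theorem shoot_s18 (hg : Continuous g) (hF : Continuous F) (hp : 0 ≤ p)
    (hg0 : ∀ x, 0 ≤ g x) (hF0 : ∀ x, 0 ≤ F x) (hlam : 0 < lam) {M d1 d2 : ℝ} (h12 : d1 ≤ d2)
    (hM : ∀ x ≤ d2, F x ≤ M)
    (hsign : (∀ ε, 0 ≤ ε → ∀ w, IsSol g F p lam ε d1 w → w 1 ≤ 0) ∧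
        (∀ ε, 0 ≤ ε → ∀ w, IsSol g F p lam ε d2 w → 0 ≤ w 1) ∨
      (∀ ε, 0 ≤ ε → ∀ w, IsSol g F p lam ε d1 w → 0 ≤ w 1) ∧
        (∀ ε, 0 ≤ ε → ∀ w, IsSol g F p lam ε d2 w → w 1 ≤ 0)) :
    ∃ v e, e ∈ Icc d1 d2 ∧ IsSol g F p lam 0 e v ∧ v 1 = 0 := by
  have hε : ∀ n : ℕ, (0:ℝ) ≤ 1 / ((n:ℝ) + 1) := fun n => by positivity
  have : ∀ n : ℕ, ∃ d ∈ Icc d1 d2, VV g F p lam (1 / ((n:ℝ) + 1)) (n + 1) d 1 = 0 := by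
    intro n
    have hc : ContinuousOn (fun d => VV g F p lam (1 / ((n:ℝ) + 1)) (n + 1) d 1) (Icc d1 d2) :=
      ((VV_cont hg hF hp (n + 1)).comp
        (by fun_prop : Continuous fun d : ℝ => (d, (1:ℝ)))).continuousOn
    rcases hsign with ⟨h1, h2⟩ | ⟨h1, h2⟩
    · exact intermediate_value_Icc h12 hc
        ⟨h1 _ (hε n) _ (VV_sol hg hF hp n d1), h2 _ (hε n) _ (VV_sol hg hF hp n d2)⟩
    · exact intermediate_value_Icc' h12 hc
        ⟨h2 _ (hε n) _ (VV_sol hg hF hp n d2), h1 _ (hε n) _ (VV_sol hg hF hp n d1)⟩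
  choose d hd hd1 using this
  exact limit_sol_s18 hg hF hp hg0 hF0 hlam hM d _ hd (fun n => VV_sol hg hF hp n (d n)) hd1

theorem IsSol.pos (hg : Continuous g) (hF : Continuous F) (hp : 0 < p)
    (hg0 : ∀ x, 0 ≤ g x) (hF0 : ∀ x, 0 ≤ F x) (hFp : ∀ x, 0 < x → 0 < F x) (hlam : 0 < lam)
    (hgp : ∀ t, 0 < t → t ≤ 1 → ∃ x ∈ Ioo 0 t, 0 < g x)
    {e : ℝ} {v : ℝ → ℝ} (he : 0 < e) (h : IsSol g F p lam 0 e v) (h1 : v 1 = 0)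
    {r : ℝ} (hr : r ∈ Ioo (0:ℝ) 1) : 0 < v r := by
  have hc := HH_cont (ε := 0) hg hF hp.le h.1
  have hd := h.diff hg hF hp.le hr.2.le le_rfl
  rw [h1, max_eq_left hr.1.le, max_eq_left zero_le_one, sub_zero] at hd
  rw [hd]
  apply mul_pos hlam
  have hHp : ∀ s, 0 < s → s ≤ 1 → 0 < HH g F p 0 v s := by
    intro s hs hs1
    apply Real.rpow_pos_of_pos
    have hev : ∀ᶠ x in 𝓝 (0:ℝ), 0 < v x := by
      apply h.1.tendsto 0 |>.eventually_const_lt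
      rw [h.zero le_rfl]; exact he
    obtain ⟨δ, hδ, hδ'⟩ := Metric.eventually_nhds_iff.1 hev
    obtain ⟨x, hx, hgx⟩ := hgp (min δ s) (lt_min hδ hs) ((min_le_right _ _).trans hs1)
    apply intervalIntegral.integral_pos hs
    · have := h.1
      exact Continuous.continuousOn (by fun_prop)
    · intro y _
      exact mul_nonneg (hg0 _) (hF0 _)
    · refine ⟨x, ⟨hx.1.le, hx.2.le.trans (min_le_right _ _)⟩, mul_pos hgx (hFp _ ?_)⟩
      rw [sub_zero]
      apply hδ'
      rw [Real.dist_eq, sub_zero, abs_of_pos hx.1]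
      exact hx.2.trans_le (min_le_left _ _)
  apply intervalIntegral.integral_pos hr.2 hc.continuousOn
  · intro y hy
    exact HH_nonneg hg0 hF0 (hr.1.le.trans hy.1.le)
  · exact ⟨1, ⟨hr.2.le, le_rfl⟩, hHp 1 one_pos le_rfl⟩
end

theorem stmt18 (N : ℕ) (hN : 1 ≤ N) (a : ℝ → ℝ)
    (ha : ContinuousOn a (Icc 0 1)) (ha0 : ∀ r ∈ Icc (0:ℝ) 1, 0 ≤ a r)
    (hanv : ∀ s t : ℝ, 0 ≤ s → s < t → t ≤ 1 → ∃ r ∈ Ioo s t, a r ≠ 0)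
    (f : ℝ → ℝ) (hf : ContinuousOn f (Ici 0))
    (hfnonneg : ∀ s ≥ (0:ℝ), 0 ≤ f s) (hfpos : ∀ s > (0:ℝ), 0 < f s)
    (h0 : Tendsto (fun s => f s / s ^ N) (nhdsWithin 0 (Ioi 0)) atTop)
    (hinf : Tendsto (fun s => f s / s ^ N) atTop atTop) :
    ∃ lamStar : ℝ, 0 < lamStar ∧ ∀ lam : ℝ, 0 < lam → lam < lamStar →
      ∃ v₁ v₂ : ℝ → ℝ, (∃ r ∈ Icc (0:ℝ) 1, v₁ r ≠ v₂ r) ∧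
        (ContinuousOn v₁ (Icc 0 1) ∧ (∀ r ∈ Icc (0:ℝ) 1, 0 ≤ v₁ r) ∧
          (∀ r ∈ Ioo (0:ℝ) 1, 0 < v₁ r) ∧
          ∀ r ∈ Icc (0:ℝ) 1, v₁ r = lam * TF N a f v₁ r) ∧
        (ContinuousOn v₂ (Icc 0 1) ∧ (∀ r ∈ Icc (0:ℝ) 1, 0 ≤ v₂ r) ∧
          (∀ r ∈ Ioo (0:ℝ) 1, 0 < v₂ r) ∧
          ∀ r ∈ Icc (0:ℝ) 1, v₂ r = lam * TF N a f v₂ r) := by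

  have hN0 : (0:ℝ) < N := by exact_mod_cast hN
  have hp : (0:ℝ) < (1:ℝ) / N := by positivity
  let q : ℝ → ℝ := fun x => max 0 (min 1 x)
  have hqc : Continuous q := by fun_prop
  have hqI : ∀ x, q x ∈ Icc (0:ℝ) 1 := fun x =>
    ⟨le_max_left _ _, max_le zero_le_one (min_le_left _ _)⟩
  have hqe : ∀ x ∈ Icc (0:ℝ) 1, q x = x := fun x hx => by
    simp only [q]; rw [min_eq_right hx.2, max_eq_right hx.1]
  obtain ⟨g, hgdef⟩ : ∃ g : ℝ → ℝ, g = fun x => (N:ℝ) * (q x) ^ (N - 1) * a (q x) := ⟨_, rfl⟩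
  obtain ⟨F, hFdef⟩ : ∃ F : ℝ → ℝ, F = fun x => f (max x 0) := ⟨_, rfl⟩
  have hg : Continuous g := by
    have : Continuous fun x => a (q x) := ha.comp_continuous hqc hqI
    rw [hgdef]; exact (continuous_const.mul (hqc.pow _)).mul this
  have hF : Continuous F := by
    rw [hFdef]
    exact hf.comp_continuous (by fun_prop) (fun x => mem_Ici.2 (le_max_right _ _))
  have hg0 : ∀ x, 0 ≤ g x := fun x => by
    rw [hgdef]
    exact mul_nonneg (mul_nonneg hN0.le (pow_nonneg (hqI x).1 _)) (ha0 _ (hqI x))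
  have hF0 : ∀ x, 0 ≤ F x := fun x => by
    rw [hFdef]; exact hfnonneg _ (le_max_right _ _)
  have hFe : ∀ x, 0 ≤ x → F x = f x := fun x hx => by
    rw [hFdef]; simp only; rw [max_eq_left hx]
  have hFp : ∀ x, 0 < x → 0 < F x := fun x hx => by
    rw [hFe x hx.le]; exact hfpos x hx
  have hgp : ∀ t, 0 < t → t ≤ 1 → ∃ x ∈ Ioo 0 t, 0 < g x := by
    intro t ht ht1
    obtain ⟨x, hx, hax⟩ := hanv 0 t le_rfl ht ht1
    have hxI : x ∈ Icc (0:ℝ) 1 := ⟨hx.1.le, hx.2.le.trans ht1⟩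
    refine ⟨x, hx, ?_⟩
    rw [hgdef]
    simp only
    rw [hqe x hxI]
    have h1 : 0 < a x := lt_of_le_of_ne (ha0 x hxI) (Ne.symm hax)
    have h2 := hx.1
    positivity
  have hbd : ∀ D : ℝ, ∃ M, ∀ x ≤ D, F x ≤ M := by
    intro D
    obtain ⟨M, hM⟩ := (isCompact_Icc (a := (0:ℝ)) (b := max D 0)).bddAbove_image hF.continuousOn
    refine ⟨M, fun x hx => ?_⟩
    have : F x = F (max x 0) := by rw [hFdef]; simp
    rw [this]
    exact hM (mem_image_of_mem _ ⟨le_max_right _ _, max_le_max hx le_rfl⟩)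
  have hc0 : 0 < ∫ x in (0:ℝ)..(1/2), g x := by
    obtain ⟨x, hx, hgx⟩ := hgp (1/2) (by norm_num) (by norm_num)
    exact intervalIntegral.integral_pos (by norm_num) hg.continuousOn (fun y _ => hg0 y)
      ⟨x, ⟨hx.1.le, hx.2.le⟩, hgx⟩
  obtain ⟨M1, hM1⟩ := hbd 1
  have hM10 : 0 ≤ M1 := (hF0 1).trans (hM1 1 le_rfl)
  have hgi : 0 ≤ ∫ x in (0:ℝ)..1, g x :=
    intervalIntegral.integral_nonneg zero_le_one (fun _ _ => hg0 _)
  obtain ⟨C, hC⟩ : ∃ C : ℝ, C = ((∫ x in (0:ℝ)..1, g x) * M1) ^ ((1:ℝ) / N) := ⟨_, rfl⟩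
  have hC0 : 0 ≤ C := by rw [hC]; positivity
  refine ⟨1 / (C + 1), by positivity, fun lam hlam hlam1 => ?_⟩
  have hlC : lam * C < 1 := by
    rw [lt_div_iff₀ (by positivity)] at hlam1
    nlinarith
  have hmid : ∀ ε, 0 ≤ ε → ∀ w, IsSol g F ((1:ℝ) / N) lam ε 1 w → 0 < w 1 := by
    intro ε hε w hw
    have h1 := hw.lip hg hF hp.le hg0 hF0 hlam hε le_rfl hM1 (r := 0) (s := 1) zero_le_one le_rfl
    rw [← hC, hw.zero le_rfl] at h1
    linarith
  -- lower bound transfer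
  have hlow : ∀ d, 0 < d → (∀ s ∈ Icc (d / 2) d,
      (4 / lam) ^ N / (∫ x in (0:ℝ)..(1/2), g x) ≤ f s / s ^ N) →
      ∀ ε, 0 ≤ ε → ∀ w, IsSol g F ((1:ℝ) / N) lam ε d w → w 1 ≤ 0 := by
    intro d hd hs ε hε w hw
    refine hw.neg hN hg hF hg0 hF0 hlam hε hd ?_
    intro s hsI
    have hs0 : 0 < s := by linarith [hsI.1]
    have h1 := hs s hsI
    rw [div_le_div_iff₀ hc0 (by positivity)] at h1
    rw [hFe s hs0.le]
    calc (2 * d / lam) ^ N = (4 / lam) ^ N * (d / 2) ^ N := by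
          rw [← mul_pow]; congr 1; ring
      _ ≤ (4 / lam) ^ N * s ^ N := by
          gcongr
          exact hsI.1
      _ ≤ _ := by linarith
  -- small parameter
  obtain ⟨δ, hδ0, hδ1, hδ⟩ : ∃ δ : ℝ, 0 < δ ∧ δ ≤ 1 ∧
      ∀ ε, 0 ≤ ε → ∀ w, IsSol g F ((1:ℝ) / N) lam ε δ w → w 1 ≤ 0 := by
    have h1 := h0.eventually_ge_atTop ((4 / lam) ^ N / (∫ x in (0:ℝ)..(1/2), g x))
    obtain ⟨u, hu, hu'⟩ := mem_nhdsGT_iff_exists_Ioc_subset.1 h1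
    have hu0 : (0:ℝ) < u := hu
    refine ⟨min u 1, lt_min hu0 one_pos, min_le_right _ _, hlow _ (lt_min hu0 one_pos) ?_⟩
    intro s hs
    have : 0 < min u 1 := lt_min hu0 one_pos
    exact hu' ⟨by linarith [hs.1], hs.2.trans (min_le_left _ _)⟩
  obtain ⟨D, hD1, hD⟩ : ∃ D : ℝ, 1 ≤ D ∧
      ∀ ε, 0 ≤ ε → ∀ w, IsSol g F ((1:ℝ) / N) lam ε D w → w 1 ≤ 0 := by
    have h1 := hinf.eventually_ge_atTop ((4 / lam) ^ N / (∫ x in (0:ℝ)..(1/2), g x))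
    obtain ⟨B, hB⟩ := eventually_atTop.1 h1
    have h2 := le_max_left (2 * B) 1
    have h3 := le_max_right (2 * B) 1
    refine ⟨max (2 * B) 1, h3, hlow _ (by linarith) ?_⟩
    intro s hs
    exact hB s (by linarith [hs.1])
  obtain ⟨MD, hMD⟩ := hbd D
  obtain ⟨v₁, e₁, he₁, hv₁, hv₁1⟩ := shoot_s18 hg hF hp.le hg0 hF0 hlam hδ1 hM1
    (Or.inl ⟨hδ, fun ε hε w hw => (hmid ε hε w hw).le⟩)
  obtain ⟨v₂, e₂, he₂, hv₂, hv₂1⟩ := shoot_s18 hg hF hp.le hg0 hF0 hlam hD1 hMD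
    (Or.inr ⟨fun ε hε w hw => (hmid ε hε w hw).le, hD⟩)
  have hfin : ∀ v e, 0 < e → IsSol g F ((1:ℝ) / N) lam 0 e v → v 1 = 0 →
      (ContinuousOn v (Icc 0 1) ∧ (∀ r ∈ Icc (0:ℝ) 1, 0 ≤ v r) ∧
          (∀ r ∈ Ioo (0:ℝ) 1, 0 < v r) ∧
          ∀ r ∈ Icc (0:ℝ) 1, v r = lam * TF N a f v r) := by
    intro v e he hv hv1
    have hnn : ∀ r ∈ Icc (0:ℝ) 1, 0 ≤ v r := fun r hr => by
      rw [← hv1]; exact hv.anti hg hF hp.le hg0 hF0 hlam hr.2 le_rfl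
    refine ⟨hv.1.continuousOn, hnn, fun r hr =>
      hv.pos hg hF hp hg0 hF0 hFp hlam hgp he hv1 hr, ?_⟩
    intro r hr
    have h1 := hv.diff hg hF hp.le hr.2 le_rfl
    rw [hv1, sub_zero, max_eq_left hr.1, max_eq_left zero_le_one] at h1
    rw [h1, TF]
    congr 1
    apply intervalIntegral.integral_congr
    intro s hs
    rw [uIcc_of_le hr.2] at hs
    simp only [HH]
    congr 1
    apply intervalIntegral.integral_congr
    intro τ hτ
    rw [uIcc_of_le (hr.1.trans hs.1)] at hτ
    have hτI : τ ∈ Icc (0:ℝ) 1 := ⟨hτ.1, hτ.2.trans hs.2⟩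
    simp only
    rw [sub_zero, hFe _ (hnn τ hτI), hgdef]
    simp only
    rw [hqe τ hτI]
  refine ⟨v₁, v₂, ⟨0, ⟨le_rfl, zero_le_one⟩, ?_⟩, hfin v₁ e₁ (hδ0.trans_le he₁.1) hv₁ hv₁1,
    hfin v₂ e₂ (one_pos.trans_le he₂.1) hv₂ hv₂1⟩
  rw [hv₁.zero le_rfl, hv₂.zero le_rfl]
  intro heq
  have he1 : e₁ = 1 := le_antisymm he₁.2 (heq ▸ he₂.1)
  rw [he1] at hv₁
  have := hmid 0 le_rfl v₁ hv₁
  linarith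
end
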